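/- arXiv:2406.16387 — 4 statements merged into one kernel-verified Lean document; each statement's English description precedes it below -/
import Mathlib

section
/- Let A be a finite totally ordered alphabet and σ : A → ℕ with σ(a) ≥ 2 for every a ∈ A. For all words U, V ∈ A*: if U ≡_{Plax(A,2)} V and for every letter a ∈ A either |U|_a = |V|_a = 0, or |U|_a ≥ 1, |V|_a ≥ 1 and |U|_a ≡ |V|_a (mod σ(a) − 1), then U ≡_{Plax(A,σ)} V. (That is, the plactic monoid is of type 1: an element of Plax(A,σ) is determined by its image in Plax(A,2) together with its evaluation in the σ-quotient of the free commutative monoid.) -/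
/-- The defining relations of the σ-plactic monoid: the Knuth relations
`acb = cab` (for `a ≤ b < c`), `bac = bca` (for `a < b ≤ c`), together with
`a^(σ a) = a` for every letter `a`. -/
def plaxRel {A : Type*} [LinearOrder A] (σ : A → ℕ) (U V : FreeMonoid A) : Prop :=
  (∃ a b c : A, a ≤ b ∧ b < c ∧
    U = FreeMonoid.of a * FreeMonoid.of c * FreeMonoid.of b ∧
    V = FreeMonoid.of c * FreeMonoid.of a * FreeMonoid.of b) ∨
  (∃ a b c : A, a < b ∧ b ≤ c ∧
    U = FreeMonoid.of b * FreeMonoid.of a * FreeMonoid.of c ∧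
    V = FreeMonoid.of b * FreeMonoid.of c * FreeMonoid.of a) ∨
  (∃ a : A, U = FreeMonoid.of a ^ σ a ∧ V = FreeMonoid.of a)

/-- The congruence on the free monoid defining the σ-plactic monoid `Plax(A, σ)`. -/
def plaxCon {A : Type*} [LinearOrder A] (σ : A → ℕ) : Con (FreeMonoid A) :=
  conGen (plaxRel σ)

/-- A generating family `x` of a monoid satisfying the Knuth relations and `x a ^ σ a = x a`. -/
structure IsPlacticFamily {A M : Type*} [LinearOrder A] [Monoid M] (σ : A → ℕ) (x : A → M) :
    Prop where
  two_le : ∀ a, 2 ≤ σ a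
  knuth_left : ∀ a b c, a ≤ b → b < c → x a * x c * x b = x c * x a * x b
  knuth_right : ∀ a b c, a < b → b ≤ c → x b * x a * x c = x b * x c * x a
  pow_eq : ∀ a, x a ^ σ a = x a
  exists_word : ∀ m, ∃ w : List A, (w.map x).prod = m

namespace IsPlacticFamily

variable {A M : Type*} [LinearOrder A] [Monoid M] {σ : A → ℕ} {x : A → M}

theorem pow_mul_self (h : IsPlacticFamily σ x) (a : A) :
    x a ^ (σ a - 2) * x a * x a = x a := by
  have h1 := h.two_le a
  rw [← pow_succ, ← pow_succ, show σ a - 2 + 1 + 1 = σ a by omega, h.pow_eq]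

theorem pow_add_mul (h : IsPlacticFamily σ x) (a : A) (k : ℕ) :
    x a ^ (1 + k * (σ a - 1)) = x a := by
  have h1 := h.two_le a
  induction k with
  | zero => simp
  | succ k ih =>
    rw [show 1 + (k + 1) * (σ a - 1) = (1 + k * (σ a - 1)) + (σ a - 1) by ring, pow_add, ih,
      ← pow_succ', show σ a - 1 + 1 = σ a by omega, h.pow_eq]

theorem commute_mul_of_lt (h : IsPlacticFamily σ x) {a b : A} (hab : a < b) :
    Commute (x b) (x b * x a) := by
  have := h.knuth_right a b b hab le_rfl
  rw [Commute, SemiconjBy, this, mul_assoc]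

theorem commute_mul_of_gt (h : IsPlacticFamily σ x) {b c : A} (hbc : b < c) :
    Commute (x b) (x c * x b) := by
  have := h.knuth_left b b c le_rfl hbc
  rw [Commute, SemiconjBy, ← this, mul_assoc]

theorem mul_pow_mul_pow (h : IsPlacticFamily σ x) {a b c : A} (hab : a < b) (hbc : b ≤ c)
    (j k : ℕ) : x b * x a ^ j * x c ^ k = x b * x c ^ k * x a ^ j := by
  have key : x b * x a * x c ^ k = x b * x c ^ k * x a := by
    cases k with
    | zero => simp
    | succ k =>
      have hc := (h.commute_mul_of_lt (hab.trans_le hbc)).pow_left k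
      calc x b * x a * x c ^ (k + 1) = x b * x a * x c * x c ^ k := by
            rw [pow_succ']; simp only [mul_assoc]
        _ = x b * (x c * x a * x c ^ k) := by
            rw [h.knuth_right a b c hab hbc]; simp only [mul_assoc]
        _ = x b * x c ^ (k + 1) * x a := by
            rw [← hc.eq, pow_succ]; simp only [mul_assoc]
  have hb := (h.commute_mul_of_lt hab)
  have hz : Commute (x b ^ (σ b - 2) * x b) (x b * x a) := (hb.pow_left _).mul_left hb
  have hy := h.pow_mul_self b
  induction j with
  | zero => simp
  | succ j ih =>
    calc x b * x a ^ (j + 1) * x c ^ k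
        = (x b ^ (σ b - 2) * x b) * (x b * x a) * (x a ^ j * x c ^ k) := by
          rw [pow_succ']; nth_rw 1 [← hy]; simp only [mul_assoc]
      _ = x b * x a * x b ^ (σ b - 2) * (x b * x a ^ j * x c ^ k) := by
          rw [hz.eq]; simp only [mul_assoc]
      _ = (x b * x a) * (x b ^ (σ b - 2) * x b) * (x c ^ k * x a ^ j) := by
          rw [ih]; simp only [mul_assoc]
      _ = x b ^ (σ b - 2) * x b * (x b * x a * x c ^ k) * x a ^ j := by
          rw [← hz.eq]; simp only [mul_assoc]
      _ = (x b ^ (σ b - 2) * x b * x b) * (x c ^ k * x a ^ (j + 1)) := by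
          rw [key, pow_succ']; simp only [mul_assoc]
      _ = _ := by rw [hy, mul_assoc]

theorem pow_mul_pow_mul (h : IsPlacticFamily σ x) {a b c : A} (hab : a ≤ b) (hbc : b < c)
    (i k : ℕ) : x a ^ i * x c ^ k * x b = x c ^ k * x a ^ i * x b := by
  have key : x a ^ i * x c * x b = x c * x a ^ i * x b := by
    cases i with
    | zero => simp
    | succ i =>
      have hc := (h.commute_mul_of_gt (hab.trans_lt hbc)).pow_left i
      calc x a ^ (i + 1) * x c * x b = x a ^ i * (x a * x c * x b) := by
            rw [pow_succ]; simp only [mul_assoc]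
        _ = x a ^ i * (x c * x a) * x b := by
            rw [h.knuth_left a b c hab hbc]; simp only [mul_assoc]
        _ = x c * x a ^ (i + 1) * x b := by
            rw [hc.eq, pow_succ']; simp only [mul_assoc]
  have hb := (h.commute_mul_of_gt hbc)
  have hz : Commute (x b * x b ^ (σ b - 2)) (x c * x b) := hb.mul_left (hb.pow_left _)
  have hy : x b * (x b * x b ^ (σ b - 2)) = x b := by
    have h3 := h.pow_mul_self b
    rwa [← pow_succ, ← pow_succ, pow_succ', pow_succ'] at h3
  induction k with
  | zero => simp
  | succ k ih =>
    calc x a ^ i * x c ^ (k + 1) * x b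
        = x a ^ i * x c ^ k * ((x c * x b) * (x b * x b ^ (σ b - 2))) := by
          rw [mul_assoc (x c), hy, pow_succ]; simp only [mul_assoc]
      _ = (x a ^ i * x c ^ k * x b) * (x b ^ (σ b - 2) * (x c * x b)) := by
          rw [← hz.eq]; simp only [mul_assoc]
      _ = x c ^ k * x a ^ i * ((x b * x b ^ (σ b - 2)) * (x c * x b)) := by
          rw [ih]; simp only [mul_assoc]
      _ = x c ^ k * (x a ^ i * x c * x b) * (x b * x b ^ (σ b - 2)) := by
          rw [hz.eq]; simp only [mul_assoc]
      _ = x c ^ (k + 1) * x a ^ i * (x b * (x b * x b ^ (σ b - 2))) := by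
          rw [key, pow_succ]; simp only [mul_assoc]
      _ = _ := by rw [hy]

/-- A letter smaller than all letters of a row commutes past the row, up to its first letter. -/
theorem mul_row_mul (h : IsPlacticFamily σ x) {l : A} (v : List A) {d : A}
    (hv : (d :: v).Pairwise (· ≤ ·)) (hl : l < d) :
    x d * (v.map x).prod * x l = x d * x l * (v.map x).prod := by
  induction v generalizing d with
  | nil => simp
  | cons e t ih =>
    rw [List.pairwise_cons] at hv
    have hde : d ≤ e := hv.1 e (by simp)
    have := ih hv.2 (hl.trans_le hde)
    calc x d * ((e :: t).map x).prod * x l = x d * (x e * (t.map x).prod * x l) := by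
          simp [mul_assoc]
      _ = x d * x e * x l * (t.map x).prod := by rw [this]; simp only [mul_assoc]
      _ = _ := by rw [← h.knuth_right l d e hl hde]; simp [mul_assoc]

/-- Schensted insertion of a letter into a row, the first letter of which is not bumped. -/
theorem row_insert (h : IsPlacticFamily σ x) {l : A} (v : List A) {d : A}
    (hv : (d :: v).Pairwise (· ≤ ·)) (hl : d ≤ l) :
    (∀ c ∈ v, c ≤ l) ∨ ∃ c, ∃ v' : List A, l < c ∧ (d :: v').Pairwise (· ≤ ·) ∧
      x d * (v.map x).prod * x l = x c * x d * (v'.map x).prod := by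
  induction v generalizing d with
  | nil => simp
  | cons e t ih =>
    have hv' := List.pairwise_cons.1 hv
    have hde : d ≤ e := hv'.1 e (by simp)
    rcases le_or_gt e l with hel | hel
    · rcases ih hv'.2 hel with hall | ⟨c, v', hc, hs, heq⟩
      · left
        simpa [hel] using hall
      · right
        refine ⟨c, e :: v', hc, ?_, ?_⟩
        · rw [List.pairwise_cons]
          refine ⟨fun z hz => ?_, hs⟩
          rcases List.mem_cons.1 hz with rfl | hz
          · exact hde
          · exact hde.trans ((List.pairwise_cons.1 hs).1 z hz)
        · calc x d * ((e :: t).map x).prod * x l = x d * (x e * (t.map x).prod * x l) := by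
                simp [mul_assoc]
            _ = x d * x c * x e * (v'.map x).prod := by rw [heq]; simp only [mul_assoc]
            _ = _ := by rw [h.knuth_left d e c hde (hel.trans_lt hc)]; simp [mul_assoc]
    · right
      refine ⟨e, l :: t, hel, ?_, ?_⟩
      · have h3 := List.pairwise_cons.1 hv'.2
        simp only [List.pairwise_cons]
        refine ⟨fun z hz => ?_, fun z hz => hel.le.trans (h3.1 z hz), h3.2⟩
        rcases List.mem_cons.1 hz with rfl | hz
        · exact hl
        · exact hde.trans (h3.1 z hz)
      · calc x d * ((e :: t).map x).prod * x l = x d * (x e * (t.map x).prod * x l) := by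
              simp [mul_assoc]
          _ = x d * x e * x l * (t.map x).prod := by
              rw [h.mul_row_mul t hv'.2 hel]; simp only [mul_assoc]
          _ = _ := by rw [h.knuth_left d l e hl hel]; simp [mul_assoc]

theorem exists_commute_mul_row (h : IsPlacticFamily σ x) (a : A) (w : List A) :
    ∃ C : M, ∃ v : List A, Commute (x a) C ∧ (a :: v).Pairwise (· ≤ ·) ∧
      x a * (w.map x).prod = C * (x a * (v.map x).prod) := by
  have hy := h.pow_mul_self a
  induction w using List.reverseRecOn with
  | nil => exact ⟨1, [], Commute.one_right _, by simp, by simp⟩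
  | append_singleton w l ih =>
    obtain ⟨C, v, hC, hv, heq⟩ := ih
    have hstep : x a * ((w ++ [l]).map x).prod = C * (x a * (v.map x).prod * x l) := by
      rw [List.map_append, List.prod_append, ← mul_assoc, heq]
      simp [mul_assoc]
    rcases lt_or_ge l a with hl | hl
    · have hc := h.commute_mul_of_lt hl
      refine ⟨C * (x a ^ (σ a - 2) * (x a * x l)), v,
        hC.mul_right (((Commute.refl _).pow_right _).mul_right hc), hv, ?_⟩
      rw [hstep, h.mul_row_mul v hv hl]
      calc C * (x a * x l * (v.map x).prod)
          = C * (x a ^ (σ a - 2) * (x a * (x a * x l)) * (v.map x).prod) := by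
            nth_rw 1 [← hy]; simp only [mul_assoc]
        _ = _ := by rw [hc.eq]; simp only [mul_assoc]
    · rcases h.row_insert v hv hl with hall | ⟨c, v', hlc, hs, hins⟩
      · refine ⟨C, v ++ [l], hC, ?_, by rw [hstep]; simp [mul_assoc]⟩
        rw [← List.cons_append, List.pairwise_append]
        refine ⟨hv, by simp, fun z hz z' hz' => ?_⟩
        rw [List.mem_singleton.1 hz']
        rcases List.mem_cons.1 hz with rfl | hz
        · exact hl
        · exact hall z hz
      · have hc := h.commute_mul_of_gt (hl.trans_lt hlc)
        refine ⟨C * (x c * x a * x a ^ (σ a - 2)), v',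
          hC.mul_right (hc.mul_right ((Commute.refl _).pow_right _)), hs, ?_⟩
        rw [hstep, hins]
        have hp : x a * x a ^ (σ a - 2) * x a = x a := by
          rw [← pow_succ', pow_succ, hy]
        calc C * (x c * x a * (v'.map x).prod)
            = C * (x c * (x a * x a ^ (σ a - 2) * x a) * (v'.map x).prod) := by rw [hp]
          _ = _ := by simp only [mul_assoc]

theorem commute_row_mul (h : IsPlacticFamily σ x) (a : A) (v : List A) (hv : ∀ c ∈ v, a ≤ c) :
    Commute (x a) ((v.map x).prod * x a) := by
  have hy := h.pow_mul_self a
  have hy' : x a * (x a * x a ^ (σ a - 2)) = x a := by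
    rwa [← pow_succ, ← pow_succ, pow_succ', pow_succ'] at hy
  have hz : Commute (x a) (x a ^ (σ a - 2)) := (Commute.refl _).pow_right _
  induction v with
  | nil => simp
  | cons c t ih =>
    have iht := ih fun z hz => hv z (by simp [hz])
    have hc : Commute (x a) (x c * x a) := by
      rcases (hv c (by simp)).eq_or_lt with rfl | hlt
      · exact (Commute.refl _).mul_right (Commute.refl _)
      · exact h.commute_mul_of_gt hlt
    have : ((c :: t).map x).prod * x a =
        (x c * x a) * (x a ^ (σ a - 2) * ((t.map x).prod * x a)) := by
      calc ((c :: t).map x).prod * x a = x c * ((t.map x).prod * x a) := by simp [mul_assoc]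
        _ = x c * (((t.map x).prod * x a) * (x a * x a ^ (σ a - 2))) := by
            rw [mul_assoc _ (x a), hy']
        _ = _ := by
            rw [← ((iht.mul_left (iht.pow_left _))).eq]; simp only [mul_assoc]
    rw [this]
    exact hc.mul_right (hz.mul_right iht)

theorem commute_mul_mul_self (h : IsPlacticFamily σ x) (a : A) (p : M) :
    Commute (x a) (x a * p * x a) := by
  obtain ⟨w, rfl⟩ := h.exists_word p
  obtain ⟨C, v, hC, hv, heq⟩ := h.exists_commute_mul_row a w
  rw [heq, mul_assoc, mul_assoc]
  exact hC.mul_right ((Commute.refl _).mul_right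
    (h.commute_row_mul a v (List.pairwise_cons.1 hv).1))

theorem pow_mul_mul_pow (h : IsPlacticFamily σ x) (a : A) (p : M) (i j : ℕ) :
    x a ^ (i + 1) * p * x a ^ (j + 1) = x a * p * x a ^ (i + j + 1) := by
  have := (h.commute_mul_mul_self a p).pow_left i
  calc x a ^ (i + 1) * p * x a ^ (j + 1) = x a ^ i * (x a * p * x a) * x a ^ j := by
        rw [pow_succ, pow_succ']; simp only [mul_assoc]
    _ = x a * p * (x a * (x a ^ i * x a ^ j)) := by rw [this.eq]; simp only [mul_assoc]
    _ = _ := by rw [← pow_add, ← pow_succ']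

end IsPlacticFamily

open scoped Pointwise

/-- The positive powers of an element. -/
def positivePowers {M : Type*} [Monoid M] (m : M) : Set M :=
  Set.range fun n : ℕ => m ^ (n + 1)

/-- An element obtained from a word by repeating its letters in place is determined by the word
and by its evaluation modulo `σ - 1`. -/
theorem IsPlacticFamily.eq_of_mem_prod_positivePowers {A M : Type*} [LinearOrder A] [Monoid M]
    {σ : A → ℕ} {x : A → M} (h : IsPlacticFamily σ x)
    (ε : (a : A) → M →* Multiplicative (ZMod (σ a - 1)))
    (hε : ∀ a b, ε a (x b) = if b = a then Multiplicative.ofAdd 1 else 1)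
    (V : List A) (m : M) (hm : m ∈ (V.map fun a => positivePowers (x a)).prod)
    (hev : ∀ a, ε a m = ε a (V.map x).prod) : m = (V.map x).prod := by
  induction V generalizing m with
  | nil => simpa using hm
  | cons a V ih =>
    rw [List.map_cons, List.prod_cons] at hm
    obtain ⟨_, ⟨i, rfl⟩, m', hm', rfl⟩ := Set.mem_mul.1 hm
    dsimp only at hev ⊢
    rw [List.map_cons, List.prod_cons] at hev ⊢
    by_cases ha : a ∈ V
    · obtain ⟨s, t, rfl⟩ := List.append_of_mem ha
      rw [List.map_append, List.prod_append, List.map_cons, List.prod_cons] at hm'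
      obtain ⟨p, hp, _, ⟨_, ⟨j, rfl⟩, q, hq, rfl⟩, rfl⟩ := hm'
      have hmove : x a ^ (i + 1) * (p * (x a ^ (j + 1) * q)) =
          x a * (p * (x a ^ (i + j + 1) * q)) := by
        have := congrArg (· * q) (h.pow_mul_mul_pow a p i j)
        simpa only [mul_assoc] using this
      dsimp only at hev ⊢
      rw [hmove]
      congr 1
      refine ih _ ?_ fun b => ?_
      · rw [List.map_append, List.prod_append, List.map_cons, List.prod_cons]
        exact Set.mul_mem_mul hp (Set.mul_mem_mul ⟨i + j, rfl⟩ hq)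
      · have := hev b
        rw [hmove, map_mul, map_mul (ε b) (x a) (List.prod _)] at this
        exact mul_left_cancel this
    · have hzero : ∀ W : List A, a ∉ W → ∀ m ∈ (W.map fun a => positivePowers (x a)).prod,
          ε a m = 1 := by
        intro W
        induction W with
        | nil => simp +contextual
        | cons b W ihW =>
          intro hW m hm
          rw [List.map_cons, List.prod_cons] at hm
          obtain ⟨_, ⟨i, rfl⟩, m', hm', rfl⟩ := Set.mem_mul.1 hm
          rw [List.mem_cons, not_or] at hW
          simp [ihW hW.2 m' hm', hε, Ne.symm hW.1]
      have hself : ∀ W : List A, (W.map x).prod ∈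
          (W.map fun a => positivePowers (x a)).prod := by
        intro W
        induction W with
        | nil => simp
        | cons b W ihW =>
          rw [List.map_cons, List.prod_cons, List.map_cons, List.prod_cons]
          exact Set.mul_mem_mul ⟨0, by simp⟩ ihW
      have hi := hev a
      rw [map_mul, map_mul, hzero V ha m' hm', hzero V ha _ (hself V), map_pow, hε, if_pos rfl,
        mul_one, mul_one, ← ofAdd_nsmul, Multiplicative.ofAdd.apply_eq_iff_eq, nsmul_one,
        Nat.cast_succ, add_eq_right, ZMod.natCast_eq_zero_iff] at hi
      obtain ⟨k, rfl⟩ := hi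
      have hx : x a ^ ((σ a - 1) * k + 1) = x a := by
        rw [add_comm, mul_comm, h.pow_add_mul]
      rw [hx] at hev ⊢
      congr 1
      refine ih m' hm' fun b => ?_
      have := hev b
      rw [map_mul, map_mul] at this
      exact mul_left_cancel this

theorem IsPlacticFamily.plaxCon_le_ker {A M : Type*} [LinearOrder A] [Monoid M]
    {σ : A → ℕ} {x : A → M} (h : IsPlacticFamily σ x) :
    plaxCon (fun _ : A => 2) ≤ Con.ker (FreeMonoid.lift fun a => positivePowers (x a)) := by
  refine Con.conGen_le.2 ?_
  rintro U V (⟨a, b, c, hab, hbc, rfl, rfl⟩ | ⟨a, b, c, hab, hbc, rfl, rfl⟩ | ⟨a, rfl, rfl⟩)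
  · rw [Con.ker_rel]
    simp only [map_mul, FreeMonoid.lift_eval_of]
    have key (i j k : ℕ) : x a ^ i * x c ^ j * x b ^ (k + 1) =
        x c ^ j * x a ^ i * x b ^ (k + 1) := by
      rw [pow_succ', ← mul_assoc, h.pow_mul_pow_mul hab hbc, mul_assoc]
    ext m
    constructor
    · rintro ⟨_, ⟨_, ⟨i, rfl⟩, _, ⟨j, rfl⟩, rfl⟩, _, ⟨k, rfl⟩, rfl⟩
      exact ⟨_, ⟨_, ⟨j, rfl⟩, _, ⟨i, rfl⟩, rfl⟩, _, ⟨k, rfl⟩, (key _ _ _).symm⟩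
    · rintro ⟨_, ⟨_, ⟨i, rfl⟩, _, ⟨j, rfl⟩, rfl⟩, _, ⟨k, rfl⟩, rfl⟩
      exact ⟨_, ⟨_, ⟨j, rfl⟩, _, ⟨i, rfl⟩, rfl⟩, _, ⟨k, rfl⟩, key _ _ _⟩
  · rw [Con.ker_rel]
    simp only [map_mul, FreeMonoid.lift_eval_of]
    have key (i j k : ℕ) : x b ^ (k + 1) * x a ^ i * x c ^ j =
        x b ^ (k + 1) * x c ^ j * x a ^ i := by
      have := congrArg (x b ^ k * ·) (h.mul_pow_mul_pow hab hbc i j)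
      simpa only [pow_succ, mul_assoc] using this
    ext m
    constructor
    · rintro ⟨_, ⟨_, ⟨i, rfl⟩, _, ⟨j, rfl⟩, rfl⟩, _, ⟨k, rfl⟩, rfl⟩
      exact ⟨_, ⟨_, ⟨i, rfl⟩, _, ⟨k, rfl⟩, rfl⟩, _, ⟨j, rfl⟩, (key _ _ _).symm⟩
    · rintro ⟨_, ⟨_, ⟨i, rfl⟩, _, ⟨j, rfl⟩, rfl⟩, _, ⟨k, rfl⟩, rfl⟩
      exact ⟨_, ⟨_, ⟨i, rfl⟩, _, ⟨k, rfl⟩, rfl⟩, _, ⟨j, rfl⟩, key _ _ _⟩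
  · rw [Con.ker_rel]
    simp only [pow_two, map_mul, FreeMonoid.lift_eval_of]
    ext m
    constructor
    · rintro ⟨_, ⟨i, rfl⟩, _, ⟨j, rfl⟩, rfl⟩
      exact ⟨i + j + 1, by dsimp only; rw [← pow_add]; congr 1; omega⟩
    · rintro ⟨i, rfl⟩
      have h2 := h.two_le a
      refine ⟨_, ⟨i, rfl⟩, _, ⟨σ a - 2, rfl⟩, ?_⟩
      dsimp only
      rw [pow_succ (x a) i, mul_assoc, ← pow_succ', show σ a - 2 + 1 + 1 = σ a by omega, h.pow_eq]

theorem isPlacticFamily_mk {A : Type*} [LinearOrder A] {σ : A → ℕ} (hσ : ∀ a, 2 ≤ σ a) :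
    IsPlacticFamily σ fun a => (plaxCon σ).mk' (FreeMonoid.of a) where
  two_le := hσ
  knuth_left a b c hab hbc := by
    simp only [← map_mul]
    exact (Con.eq _).2 (ConGen.Rel.of _ _ (.inl ⟨a, b, c, hab, hbc, rfl, rfl⟩))
  knuth_right a b c hab hbc := by
    simp only [← map_mul]
    exact (Con.eq _).2 (ConGen.Rel.of _ _ (.inr (.inl ⟨a, b, c, hab, hbc, rfl, rfl⟩)))
  pow_eq a := by
    simp only [← map_pow]
    exact (Con.eq _).2 (ConGen.Rel.of _ _ (.inr (.inr ⟨a, rfl, rfl⟩)))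
  exists_word m := by
    obtain ⟨w, rfl⟩ := Con.mk'_surjective m
    refine ⟨w.toList, ?_⟩
    rw [← FreeMonoid.lift_apply]
    exact DFunLike.congr_fun (FreeMonoid.hom_eq fun a => by simp) w

/-- The number of occurrences of a letter, modulo `n`. -/
def countMod {A : Type*} [DecidableEq A] (n : ℕ) (a : A) :
    FreeMonoid A →* Multiplicative (ZMod n) :=
  FreeMonoid.lift fun b => if b = a then Multiplicative.ofAdd 1 else 1

theorem countMod_apply {A : Type*} [DecidableEq A] (n : ℕ) (a : A) (U : FreeMonoid A) :
    countMod n a U = Multiplicative.ofAdd (U.toList.count a : ZMod n) := by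
  induction U using FreeMonoid.inductionOn' with
  | one => simp
  | of_mul b U ih =>
    rw [map_mul, ih, FreeMonoid.toList_of_mul, List.count_cons]
    by_cases hb : b = a <;> simp [countMod, hb, add_comm]

theorem plaxCon_le_ker_countMod {A : Type*} [LinearOrder A] {σ : A → ℕ} (hσ : ∀ a, 2 ≤ σ a)
    (a : A) : plaxCon σ ≤ Con.ker (countMod (σ a - 1) a) := by
  refine Con.conGen_le.2 ?_
  rintro U V (⟨b, c, d, -, -, rfl, rfl⟩ | ⟨b, c, d, -, -, rfl, rfl⟩ | ⟨b, rfl, rfl⟩)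
  · rw [Con.ker_rel]
    simp only [map_mul]
    ac_rfl
  · rw [Con.ker_rel]
    simp only [map_mul]
    ac_rfl
  · rw [Con.ker_rel, map_pow]
    by_cases hb : b = a
    · subst hb
      have h2 := hσ b
      have : ((σ b : ℕ) : ZMod (σ b - 1)) = 1 := by
        rw [← @Nat.cast_one (ZMod (σ b - 1)), ZMod.natCast_eq_natCast_iff]
        exact ((Nat.modEq_iff_dvd' (by omega)).2 dvd_rfl).symm
      simp only [countMod, FreeMonoid.lift_eval_of, if_true]
      rw [← ofAdd_nsmul, nsmul_one, this]
    · simp [countMod, hb]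

/-- The plactic monoid is of type 1: if two words are equivalent in `Plax(A,2)`
(the stylic monoid) and, for every letter `a`, either `a` occurs in neither word,
or it occurs in both and its numbers of occurrences agree modulo `σ(a) - 1`,
then the words are equivalent in `Plax(A,σ)`. -/
theorem plactic_type1 {A : Type*} [LinearOrder A] [Fintype A]
    (σ : A → ℕ) (hσ : ∀ a : A, 2 ≤ σ a) (U V : FreeMonoid A)
    (h2 : plaxCon (fun _ : A => 2) U V)
    (hev : ∀ a : A,
      (U.toList.count a = 0 ∧ V.toList.count a = 0) ∨
      (1 ≤ U.toList.count a ∧ 1 ≤ V.toList.count a ∧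
        U.toList.count a % (σ a - 1) = V.toList.count a % (σ a - 1))) :
    plaxCon σ U V := by
  have h := isPlacticFamily_mk hσ
  have hmem (W : FreeMonoid A) : (plaxCon σ).mk' W ∈ FreeMonoid.lift
      (fun a => positivePowers ((plaxCon σ).mk' (FreeMonoid.of a))) W := by
    induction W using FreeMonoid.inductionOn' with
    | one => simp
    | of_mul b W ih =>
      rw [map_mul, map_mul, FreeMonoid.lift_eval_of]
      exact Set.mul_mem_mul ⟨0, by simp⟩ ih
  have hUV : FreeMonoid.lift (fun a => positivePowers ((plaxCon σ).mk' (FreeMonoid.of a))) U =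
      FreeMonoid.lift (fun a => positivePowers ((plaxCon σ).mk' (FreeMonoid.of a))) V :=
    h.plaxCon_le_ker h2
  have hU := hmem U
  rw [hUV, FreeMonoid.lift_apply] at hU
  have hV : (V.toList.map fun a => (plaxCon σ).mk' (FreeMonoid.of a)).prod =
      (plaxCon σ).mk' V := by
    rw [← FreeMonoid.lift_apply]
    exact DFunLike.congr_fun (FreeMonoid.hom_eq fun a => by simp) V
  have heq := h.eq_of_mem_prod_positivePowers
    (fun a => (plaxCon σ).lift (countMod (σ a - 1) a) (plaxCon_le_ker_countMod hσ a))
    (fun a b => by simp [countMod]) V.toList _ hU fun a => by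
      rw [hV, Con.lift_mk', Con.lift_mk', countMod_apply, countMod_apply]
      congr 1
      rw [ZMod.natCast_eq_natCast_iff]
      rcases hev a with ⟨h1, h2⟩ | ⟨-, -, h3⟩
      · rw [h1, h2]
      · exact h3
  exact (Con.eq _).1 (heq.trans hV)
end

section
/- Let A be a finite totally ordered alphabet and σ : A → ℕ with σ(a) ≥ 2 for every a ∈ A. For all words U, V ∈ A*: if U ≡_{Ch(A,2)} V and for every letter a ∈ A either |U|_a = |V|_a = 0, or |U|_a ≥ 1, |V|_a ≥ 1 and |U|_a ≡ |V|_a (mod σ(a) − 1), then U ≡_{Ch(A,σ)} V. (That is, the Chinese monoid is of type 1: an element of Ch(A,σ) is determined by its image in Ch(A,2) together with its evaluation in the σ-quotient of the free commutative monoid.) -/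
/-- The defining relations of the σ-Chinese monoid: `cba = cab = bca` (for `a < b < c`),
`aba = baa` and `bba = bab` (for `a < b`), together with `a^(σ a) = a` for every letter. -/
def chineseRel {A : Type*} [LinearOrder A] (σ : A → ℕ) (U V : FreeMonoid A) : Prop :=
  (∃ a b c : A, a < b ∧ b < c ∧
    U = FreeMonoid.of c * FreeMonoid.of b * FreeMonoid.of a ∧
    V = FreeMonoid.of c * FreeMonoid.of a * FreeMonoid.of b) ∨
  (∃ a b c : A, a < b ∧ b < c ∧
    U = FreeMonoid.of c * FreeMonoid.of a * FreeMonoid.of b ∧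
    V = FreeMonoid.of b * FreeMonoid.of c * FreeMonoid.of a) ∨
  (∃ a b : A, a < b ∧
    U = FreeMonoid.of a * FreeMonoid.of b * FreeMonoid.of a ∧
    V = FreeMonoid.of b * FreeMonoid.of a * FreeMonoid.of a) ∨
  (∃ a b : A, a < b ∧
    U = FreeMonoid.of b * FreeMonoid.of b * FreeMonoid.of a ∧
    V = FreeMonoid.of b * FreeMonoid.of a * FreeMonoid.of b) ∨
  (∃ a : A, U = FreeMonoid.of a ^ σ a ∧ V = FreeMonoid.of a)

/-- The congruence on the free monoid defining the σ-Chinese monoid `Ch(A, σ)`. -/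
def chineseCon {A : Type*} [LinearOrder A] (σ : A → ℕ) : Con (FreeMonoid A) :=
  conGen (chineseRel σ)

/-- A family `g` of elements of a monoid satisfying the relations of the `σ`-Chinese monoid. -/
structure IsChinese {A M : Type*} [LinearOrder A] [Monoid M] (σ : A → ℕ) (g : A → M) : Prop where
  cba_cab : ∀ {a b c : A}, a < b → b < c → g c * g b * g a = g c * g a * g b
  cab_bca : ∀ {a b c : A}, a < b → b < c → g c * g a * g b = g b * g c * g a
  aba : ∀ {a b : A}, a < b → g a * g b * g a = g b * g a * g a
  bba : ∀ {a b : A}, a < b → g b * g b * g a = g b * g a * g b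
  pow : ∀ a : A, g a ^ σ a = g a
  two_le : ∀ a : A, 2 ≤ σ a

/-- The product of `g` along a word, with each letter `a` raised to the power `σ a - 1`, and
`n a` extra copies of `a` inserted at its first occurrence. -/
def inflate {A M : Type*} [DecidableEq A] [Monoid M] (σ : A → ℕ) (g : A → M) :
    (A → ℕ) → List A → M
  | _, [] => 1
  | n, a :: w => g a ^ (n a + (σ a - 1)) * inflate σ g (Function.update n a 0) w

namespace IsChinese

variable {A M : Type*} [LinearOrder A] [Monoid M] {σ : A → ℕ} {g : A → M}

theorem pow_succ_eq (h : IsChinese σ g) (a : A) (n : ℕ) :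
    g a ^ (n + 1 + (σ a - 1)) = g a ^ (n + 1) := by
  have h1 := h.pow a
  have h2 := h.two_le a
  rw [show n + 1 + (σ a - 1) = n + σ a by omega, pow_add, h1, pow_succ]

theorem pow_add_mul (h : IsChinese σ g) (a : A) (n k : ℕ) :
    g a ^ (n + 1 + (σ a - 1) * k) = g a ^ (n + 1) := by
  induction k with
  | zero => simp
  | succ k ih =>
    rw [show n + 1 + (σ a - 1) * (k + 1) = (n + (σ a - 1) * k) + 1 + (σ a - 1) by ring,
      h.pow_succ_eq, ← ih]
    congr 1
    ring

theorem pow_eq_of_modEq (h : IsChinese σ g) (a : A) {i j : ℕ} (hi : 1 ≤ i) (hj : 1 ≤ j)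
    (hij : i ≡ j [MOD σ a - 1]) : g a ^ i = g a ^ j := by
  wlog hle : i ≤ j generalizing i j
  · exact (this hj hi hij.symm (by omega)).symm
  obtain ⟨k, hk⟩ := (Nat.modEq_iff_dvd' hle).1 hij
  obtain ⟨n, rfl⟩ : ∃ n, i = n + 1 := ⟨i - 1, by omega⟩
  rw [show j = n + 1 + (σ a - 1) * k by omega, h.pow_add_mul]

theorem mul_pow_self (h : IsChinese σ g) (a : A) : g a * g a ^ (σ a - 1) = g a := by
  have := h.pow_succ_eq a 0
  rwa [pow_add, zero_add, pow_one] at this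

theorem pow_mul_self (h : IsChinese σ g) (a : A) : g a ^ (σ a - 1) * g a = g a := by
  rw [← pow_succ, pow_succ', h.mul_pow_self]

/-- `ba` commutes with `a` for `a < b`. -/
theorem commute_left (h : IsChinese σ g) {a b : A} (hab : a < b) :
    Commute (g a) (g b * g a) := by
  have := h.aba hab
  rwa [mul_assoc] at this

/-- `ba` commutes with `b` for `a < b`. -/
theorem commute_right (h : IsChinese σ g) {a b : A} (hab : a < b) :
    Commute (g b) (g b * g a) := by
  have := h.bba hab
  rwa [mul_assoc] at this

theorem commute_mid (h : IsChinese σ g) {a b c : A} (hab : a < b) (hbc : b < c) :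
    Commute (g b) (g c * g a) := by
  have := h.cab_bca hab hbc
  rw [mul_assoc (g b)] at this
  exact this.symm

theorem commute_lt_mul (h : IsChinese σ g) {a b : A} (hab : a < b) {y : M}
    (hy : Commute (g a) y) (hya : y * g a ^ (σ a - 1) = y) : Commute (g a) (g b * y) := by
  obtain ⟨k, hk⟩ : ∃ k, σ a - 1 = k + 1 := ⟨σ a - 2, by have := h.two_le a; omega⟩
  have hay : g a ^ (k + 1) * y = y := by rw [← hk, (hy.pow_left _).eq, hya]
  have key : g b * y = g b * g a * (g a ^ k * y) := by
    rw [mul_assoc, ← mul_assoc (g a), ← pow_succ', hay]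
  rw [key]
  exact (h.commute_left hab).mul_right (((Commute.refl (g a)).pow_right k).mul_right hy)

theorem commute_mul_lt (h : IsChinese σ g) {a b : A} (hab : a < b) {y : M}
    (hy : Commute (g b) y) (hby : g b ^ (σ b - 1) * y = y) : Commute (g b) (y * g a) := by
  obtain ⟨k, hk⟩ : ∃ k, σ b - 1 = k + 1 := ⟨σ b - 2, by have := h.two_le b; omega⟩
  have hyb : y * g b ^ (k + 1) = y := by rw [← hk, ← (hy.pow_left _).eq, hby]
  have key : y * g a = y * g b ^ k * (g b * g a) := by
    rw [mul_assoc, ← mul_assoc (g b ^ k), ← pow_succ, ← mul_assoc, hyb]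
  rw [key]
  exact (hy.mul_right ((Commute.refl (g b)).pow_right k)).mul_right (h.commute_right hab)

theorem commute_pow_mul (h : IsChinese σ g) {a b : A} (hab : a < b) (j : ℕ) :
    Commute (g a) (g b ^ j * g a) := by
  induction j with
  | zero => simp
  | succ j ih =>
    rw [pow_succ', mul_assoc]
    exact h.commute_lt_mul hab ih (by rw [mul_assoc, h.mul_pow_self])

theorem commute_mul_pow (h : IsChinese σ g) {a b : A} (hab : a < b) (j : ℕ) :
    Commute (g b) (g b * g a ^ j) := by
  induction j with
  | zero => simp
  | succ j ih =>
    rw [pow_succ, ← mul_assoc]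
    exact h.commute_mul_lt hab ih (by rw [← mul_assoc, h.pow_mul_self])

theorem pow_aba (h : IsChinese σ g) {a b : A} (hab : a < b) (i j : ℕ) {k : ℕ} (hk : 1 ≤ k) :
    g a ^ i * (g b ^ j * g a ^ k) = g b ^ j * (g a ^ i * g a ^ k) := by
  obtain ⟨k, rfl⟩ : ∃ l, k = l + 1 := ⟨k - 1, by omega⟩
  have := ((h.commute_pow_mul hab j).pow_left i).eq
  rw [pow_succ' (g a) k, ← mul_assoc (g b ^ j), ← mul_assoc, this]
  simp only [mul_assoc]
  rw [← mul_assoc (g a), ← pow_succ', pow_succ, mul_assoc (g a ^ i)]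

theorem pow_bba (h : IsChinese σ g) {a b : A} (hab : a < b) {i : ℕ} (j k : ℕ) (hi : 1 ≤ i) :
    g b ^ i * (g b ^ j * g a ^ k) = g b ^ i * (g a ^ k * g b ^ j) := by
  obtain ⟨i, rfl⟩ : ∃ l, i = l + 1 := ⟨i - 1, by omega⟩
  have := ((h.commute_mul_pow hab k).pow_left j).eq
  rw [pow_succ (g b) i, mul_assoc (g b ^ i), mul_assoc (g b ^ i), ← mul_assoc (g b) (g a ^ k),
    ← this, ← mul_assoc (g b), ← mul_assoc (g b ^ j), ← pow_succ, ← pow_succ']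

theorem mul_pow_mul_eq_mul_mul_pow (h : IsChinese σ g) {a b c : A} (hab : a < b) (hbc : b < c)
    (j : ℕ) : g c * (g b ^ j * g a) = g c * g a * g b ^ j := by
  cases j with
  | zero => simp
  | succ j =>
    rw [pow_succ, mul_assoc, ((h.commute_right hab).pow_left j).eq, ← mul_assoc, ← mul_assoc,
      h.cba_cab hab hbc, mul_assoc, ← pow_succ', ← pow_succ]

theorem mul_pow_mul_eq_pow_mul_mul (h : IsChinese σ g) {a b c : A} (hab : a < b) (hbc : b < c)
    (j : ℕ) : g c * g b ^ j * g a = g b ^ j * (g c * g a) := by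
  rw [mul_assoc, h.mul_pow_mul_eq_mul_mul_pow hab hbc,
    ((h.commute_mid hab hbc).pow_left j).eq]

theorem pow_cba_cab (h : IsChinese σ g) {a b c : A} (hab : a < b) (hbc : b < c) {i k : ℕ}
    (j : ℕ) (hi : 1 ≤ i) (hk : 1 ≤ k) :
    g c ^ i * (g b ^ j * g a ^ k) = g c ^ i * (g a ^ k * g b ^ j) := by
  obtain ⟨i, rfl⟩ : ∃ l, i = l + 1 := ⟨i - 1, by omega⟩
  obtain ⟨k, rfl⟩ : ∃ l, k = l + 1 := ⟨k - 1, by omega⟩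
  have hcomm : Commute (g a) (g c * (g b ^ j * g a)) :=
    h.commute_lt_mul (hab.trans hbc) (h.commute_pow_mul hab j)
      (by rw [mul_assoc, h.mul_pow_self])
  have key : g c * (g b ^ j * g a ^ (k + 1)) = g c * (g a ^ (k + 1) * g b ^ j) := by
    calc g c * (g b ^ j * g a ^ (k + 1)) = g c * (g b ^ j * g a) * g a ^ k := by
          rw [pow_succ']; simp only [mul_assoc]
      _ = g a ^ k * (g c * g a) * g b ^ j := by
          rw [← (hcomm.pow_left k).eq, h.mul_pow_mul_eq_mul_mul_pow hab hbc]
          simp only [mul_assoc]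
      _ = g c * (g a ^ (k + 1) * g b ^ j) := by
          rw [((h.commute_left (hab.trans hbc)).pow_left k).eq, pow_succ']
          simp only [mul_assoc]
  rw [pow_succ, mul_assoc, key, ← mul_assoc]

theorem pow_cab_bca (h : IsChinese σ g) {a b c : A} (hab : a < b) (hbc : b < c) {i k : ℕ}
    (j : ℕ) (hi : 1 ≤ i) (hk : 1 ≤ k) :
    g c ^ i * (g a ^ k * g b ^ j) = g b ^ j * (g c ^ i * g a ^ k) := by
  rw [← h.pow_cba_cab hab hbc j hi hk]
  obtain ⟨i, rfl⟩ : ∃ l, i = l + 1 := ⟨i - 1, by omega⟩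
  obtain ⟨k, rfl⟩ : ∃ l, k = l + 1 := ⟨k - 1, by omega⟩
  have hcomm : Commute (g c) (g c * g b ^ j * g a) :=
    h.commute_mul_lt (hab.trans hbc) (h.commute_mul_pow hbc j)
      (by rw [← mul_assoc, h.pow_mul_self])
  have key : g c ^ (i + 1) * (g b ^ j * g a) = g b ^ j * (g c ^ (i + 1) * g a) := by
    calc g c ^ (i + 1) * (g b ^ j * g a) = g c ^ i * (g c * g b ^ j * g a) := by
          rw [pow_succ]; simp only [mul_assoc]
      _ = g b ^ j * (g c * g a * g c ^ i) := by
          rw [(hcomm.pow_left i).eq, h.mul_pow_mul_eq_pow_mul_mul hab hbc]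
          simp only [mul_assoc]
      _ = g b ^ j * (g c ^ (i + 1) * g a) := by
          rw [← ((h.commute_right (hab.trans hbc)).pow_left i).eq, pow_succ]
          simp only [mul_assoc]
  rw [pow_succ' (g a), ← mul_assoc (g b ^ j), ← mul_assoc, key]
  simp only [mul_assoc]

/-- A product `l * t * t'` with `t, t' ≤ x < l` can be rewritten to start with a letter `≤ x`. -/
theorem exists_le_mul_mul (h : IsChinese σ g) {x l t t' : A} (hl : x < l) (ht : t ≤ x)
    (ht' : t' ≤ x) : ∃ s ≤ x, ∃ s', g l * g t * g t' = g s * (g l * g s') := by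
  rcases lt_trichotomy t t' with hlt | rfl | hlt
  · exact ⟨t', ht', t, by rw [h.cab_bca hlt (ht'.trans_lt hl), mul_assoc]⟩
  · exact ⟨t, ht, t, by rw [← h.aba (ht.trans_lt hl), mul_assoc]⟩
  · exact ⟨t, ht, t', by
      rw [h.cba_cab hlt (ht.trans_lt hl), h.cab_bca hlt (ht.trans_lt hl), mul_assoc]⟩

/-- Either `x` commutes with `v x`, or `v` can be rewritten to start with a letter `≤ x`. -/
theorem commute_or_exists_le (h : IsChinese σ g) (x : A) (v : List A) :
    Commute (g x) ((v.map g).prod * g x) ∨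
      ∃ t ≤ x, ∃ u : List A, u.length < v.length ∧ (v.map g).prod = g t * (u.map g).prod := by
  induction hn : v.length using Nat.strong_induction_on generalizing v with
  | _ n ih =>
    subst hn
    match v with
    | [] => simp
    | l :: v =>
      rcases le_or_gt l x with hl | hl
      · exact Or.inr ⟨l, hl, v, by simp, by simp⟩
      rcases ih v.length (by simp) v rfl with hv | ⟨t, ht, u, hu, hvu⟩
      · left
        rw [List.map_cons, List.prod_cons, mul_assoc]
        exact h.commute_lt_mul hl hv (by rw [mul_assoc, h.mul_pow_self])
      rw [List.map_cons, List.prod_cons, hvu]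
      rcases ih u.length (by simp; omega) u rfl with hu' | ⟨t', ht', u', hu', huu⟩
      · left
        have hlt : Commute (g x) (g l * g t) := by
          rcases ht.eq_or_lt with rfl | ht
          · exact h.commute_left hl
          · exact h.commute_mid ht hl
        have := hlt.mul_right hu'
        simpa only [mul_assoc] using this
      · right
        obtain ⟨s, hs, s', hss⟩ := h.exists_le_mul_mul hl ht ht'
        refine ⟨s, hs, l :: s' :: u', by simp; omega, ?_⟩
        rw [huu, ← mul_assoc, ← mul_assoc, hss]
        simp [mul_assoc]

/-- A letter commutes with every word that starts and ends with it. -/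
theorem commute_mul_prod_mul (h : IsChinese σ g) (x : A) (v : List A) :
    Commute (g x) (g x * (v.map g).prod * g x) := by
  induction hn : v.length using Nat.strong_induction_on generalizing v with
  | _ n ih =>
    subst hn
    rcases h.commute_or_exists_le x v with hv | ⟨t, ht, u, hu, hvu⟩
    · rw [mul_assoc]
      exact (Commute.refl _).mul_right hv
    have hq := ih u.length hu u rfl
    rw [hvu]
    rcases ht.eq_or_lt with rfl | ht
    · rw [mul_assoc, mul_assoc, ← mul_assoc (g t) (u.map g).prod]
      exact (Commute.refl _).mul_right hq
    obtain ⟨k, hk⟩ : ∃ k, σ x - 1 = k + 1 := ⟨σ x - 2, by have := h.two_le x; omega⟩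
    have hxt := h.commute_right ht
    have key : g x * (g t * (u.map g).prod) * g x
        = g x * g t * g x ^ k * (g x * (u.map g).prod * g x) := by
      have h1 : g x * g t * g x ^ (k + 1) = g x * g t := by
        rw [← hk, ← (hxt.pow_left _).eq, ← mul_assoc, h.pow_mul_self]
      calc _ = g x * g t * ((u.map g).prod * g x) := by simp only [mul_assoc]
        _ = g x * g t * g x ^ (k + 1) * ((u.map g).prod * g x) := by rw [h1]
        _ = _ := by rw [pow_succ]; simp only [mul_assoc]
    rw [key]
    exact (hxt.mul_right ((Commute.refl _).pow_right k)).mul_right hq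

theorem mul_prod_mul_inflate (h : IsChinese σ g) (x : A) (v w : List A) (n : A → ℕ)
    (hx : x ∈ w) :
    g x * (v.map g).prod * inflate σ g n w
      = g x ^ (n x + 1) * (v.map g).prod * inflate σ g (Function.update n x 0) w := by
  induction w generalizing v n with
  | nil => simp at hx
  | cons b w ih =>
    by_cases hb : b = x
    · subst hb
      obtain ⟨k, hk⟩ : ∃ k, σ b - 1 = k + 1 := ⟨σ b - 2, by have := h.two_le b; omega⟩
      have hc := ((h.commute_mul_prod_mul b v).pow_left (n b)).eq
      have key : g b * (v.map g).prod * g b ^ (n b + (k + 1))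
          = g b ^ (n b + 1) * (v.map g).prod * g b ^ (k + 1) := by
        calc _ = g b * (v.map g).prod * g b * g b ^ n b * g b ^ k := by
              rw [show n b + (k + 1) = 1 + n b + k by ring, pow_add, pow_add, pow_one]
              simp only [mul_assoc]
          _ = _ := by
              rw [← hc, pow_succ (g b) (n b), pow_succ' (g b) k]
              simp only [mul_assoc]
      simp only [inflate, Function.update_self, Function.update_idem, zero_add, hk]
      rw [← mul_assoc, key, mul_assoc]
    · have hxw : x ∈ w := by
        rcases List.mem_cons.1 hx with rfl | hx
        · exact absurd rfl hb
        · exact hx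
      have := ih (v ++ List.replicate (n b + (σ b - 1)) b) (Function.update n b 0) hxw
      simp only [List.map_append, List.prod_append, List.map_replicate, List.prod_replicate,
        Function.update_of_ne (Ne.symm hb)] at this
      simp only [inflate, Function.update_of_ne hb]
      rw [Function.update_comm hb] at this
      simpa only [mul_assoc] using this

theorem inflate_congr (h : IsChinese σ g) (w : List A) {n n' : A → ℕ}
    (hn : ∀ a, n a ≡ n' a [MOD σ a - 1]) : inflate σ g n w = inflate σ g n' w := by
  induction w generalizing n n' with
  | nil => rfl
  | cons a w ih =>
    have h2 := h.two_le a
    simp only [inflate]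
    rw [h.pow_eq_of_modEq a (by omega) (by omega) ((hn a).add_right _),
      ih (n := Function.update n a 0) (n' := Function.update n' a 0)]
    intro b
    rcases eq_or_ne b a with rfl | hb
    · simp only [Function.update_self]
      rfl
    · simpa only [Function.update_of_ne hb] using hn b

theorem inflate_count (h : IsChinese σ g) (w : List A) :
    inflate σ g (fun a => w.count a) w = (w.map g).prod := by
  induction w with
  | nil => rfl
  | cons a w ih =>
    have hupd : Function.update (fun b => (a :: w).count b) a 0
        = Function.update (fun b => w.count b) a 0 := by
      ext b
      rcases eq_or_ne b a with rfl | hb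
      · simp
      · simp [Function.update_of_ne hb, List.count_cons_of_ne hb.symm]
    simp only [inflate, List.count_cons_self, hupd, h.pow_succ_eq, List.map_cons, List.prod_cons]
    rw [← ih]
    by_cases ha : a ∈ w
    · simpa using (h.mul_prod_mul_inflate a [] w (fun b => w.count b) ha).symm
    · rw [List.count_eq_zero_of_not_mem ha, zero_add, pow_one,
        Function.update_eq_self_iff.2 (List.count_eq_zero_of_not_mem ha).symm]

end IsChinese

theorem inflate_append {A M : Type*} [DecidableEq A] [Monoid M] (σ : A → ℕ) (g : A → M)
    (n : A → ℕ) (u v : List A) :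
    inflate σ g n (u ++ v)
      = inflate σ g n u * inflate σ g (fun a => if a ∈ u then 0 else n a) v := by
  induction u generalizing n with
  | nil => simp [inflate]
  | cons b u ih =>
    simp only [List.cons_append, inflate, ih, mul_assoc]
    congr 3
    ext a
    rcases eq_or_ne a b with rfl | hab
    · simp
    · simp [hab]

/-- The congruence identifying words with the same letters and the same inflations. -/
def inflateCon {A M : Type*} [DecidableEq A] [Monoid M] (σ : A → ℕ) (g : A → M) :
    Con (FreeMonoid A) where
  r U V := (∀ a, a ∈ U.toList ↔ a ∈ V.toList) ∧
    ∀ n, inflate σ g n U.toList = inflate σ g n V.toList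
  iseqv :=
    { refl := fun _ => ⟨fun _ => Iff.rfl, fun _ => rfl⟩
      symm := fun h => ⟨fun a => (h.1 a).symm, fun n => (h.2 n).symm⟩
      trans := fun h h' => ⟨fun a => (h.1 a).trans (h'.1 a), fun n => (h.2 n).trans (h'.2 n)⟩ }
  mul' := by
    intro U V U' V' h h'
    refine ⟨fun a => ?_, fun n => ?_⟩
    · simp only [FreeMonoid.toList_mul, List.mem_append, h.1 a, h'.1 a]
    · simp only [FreeMonoid.toList_mul, inflate_append, h.2, h'.2, h.1]

theorem IsChinese.chineseCon_two_le_inflateCon {A M : Type*} [LinearOrder A] [Monoid M]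
    {σ : A → ℕ} {g : A → M} (h : IsChinese σ g) :
    chineseCon (fun _ : A => 2) ≤ inflateCon σ g := by
  refine Con.conGen_le.2 ?_
  have h2 := h.two_le
  have pos : ∀ (n : ℕ) (a : A), 1 ≤ n + (σ a - 1) := fun n a => by have := h2 a; omega
  rintro U V (⟨a, b, c, hab, hbc, rfl, rfl⟩ | ⟨a, b, c, hab, hbc, rfl, rfl⟩ |
    ⟨a, b, hab, rfl, rfl⟩ | ⟨a, b, hab, rfl, rfl⟩ | ⟨a, rfl, rfl⟩)
  · refine ⟨fun x => by simp; tauto, fun n => ?_⟩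
    simpa [inflate, hab.ne, hbc.ne, (hab.trans hbc).ne, hab.ne', hbc.ne', (hab.trans hbc).ne']
      using h.pow_cba_cab hab hbc _ (pos _ _) (pos _ _)
  · refine ⟨fun x => by simp; tauto, fun n => ?_⟩
    simpa [inflate, hab.ne, hbc.ne, (hab.trans hbc).ne, hab.ne', hbc.ne', (hab.trans hbc).ne']
      using h.pow_cab_bca hab hbc _ (pos _ _) (pos _ _)
  · refine ⟨fun x => by simp; tauto, fun n => ?_⟩
    simpa [inflate, hab.ne, hab.ne'] using h.pow_aba hab _ _ (pos 0 a)
  · refine ⟨fun x => by simp; tauto, fun n => ?_⟩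
    simpa [inflate, hab.ne, hab.ne'] using h.pow_bba hab _ _ (pos _ _)
  · refine ⟨fun x => by simp [pow_two], fun n => ?_⟩
    obtain ⟨k, hk⟩ := Nat.exists_eq_add_of_le' (pos (n a) a)
    simp only [pow_two, FreeMonoid.toList_mul, FreeMonoid.toList_of, List.cons_append,
      List.nil_append, inflate, Function.update_self, mul_one, zero_add]
    rw [hk, ← pow_add, h.pow_succ_eq]

theorem isChinese_mk {A : Type*} [LinearOrder A] {σ : A → ℕ} (hσ : ∀ a, 2 ≤ σ a) :
    IsChinese σ fun a => (FreeMonoid.of a : (chineseCon σ).Quotient) where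
  cba_cab {a b c} hab hbc := (Con.eq _).2 (.of _ _ (.inl ⟨a, b, c, hab, hbc, rfl, rfl⟩))
  cab_bca {a b c} hab hbc :=
    (Con.eq _).2 (.of _ _ (.inr (.inl ⟨a, b, c, hab, hbc, rfl, rfl⟩)))
  aba {a b} hab := (Con.eq _).2 (.of _ _ (.inr (.inr (.inl ⟨a, b, hab, rfl, rfl⟩))))
  bba {a b} hab := (Con.eq _).2 (.of _ _ (.inr (.inr (.inr (.inl ⟨a, b, hab, rfl, rfl⟩)))))
  pow a := (Con.eq _).2 (.of _ _ (.inr (.inr (.inr (.inr ⟨a, rfl, rfl⟩)))))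
  two_le := hσ

/-- The Chinese monoid is of type 1: if two words are equivalent in `Ch(A,2)`
and, for every letter `a`, either `a` occurs in neither word, or it occurs in both
and its numbers of occurrences agree modulo `σ(a) - 1`, then the words are
equivalent in `Ch(A,σ)`. -/
theorem chinese_type1 {A : Type*} [LinearOrder A] [Fintype A]
    (σ : A → ℕ) (hσ : ∀ a : A, 2 ≤ σ a) (U V : FreeMonoid A)
    (h2 : chineseCon (fun _ : A => 2) U V)
    (hev : ∀ a : A,
      (U.toList.count a = 0 ∧ V.toList.count a = 0) ∨
      (1 ≤ U.toList.count a ∧ 1 ≤ V.toList.count a ∧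
        U.toList.count a % (σ a - 1) = V.toList.count a % (σ a - 1))) :
    chineseCon σ U V := by
  set g : A → (chineseCon σ).Quotient := fun a => (FreeMonoid.of a : (chineseCon σ).Quotient)
    with hg
  have h : IsChinese σ g := isChinese_mk hσ
  have hprod : ∀ W : FreeMonoid A, (W : (chineseCon σ).Quotient) = (W.toList.map g).prod := by
    intro W
    have : (chineseCon σ).mk' = FreeMonoid.lift g := FreeMonoid.hom_eq fun a => by simp [hg]
    rw [← FreeMonoid.lift_apply, ← this]
    rfl
  refine (Con.eq _).1 ?_
  rw [hprod, hprod, ← h.inflate_count, ← h.inflate_count,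
    (h.chineseCon_two_le_inflateCon h2).2]
  refine h.inflate_congr _ fun a => ?_
  rcases hev a with ⟨hU, hV⟩ | ⟨-, -, hUV⟩
  · rw [hU, hV]
  · exact hUV
end

section
/- Let A be a finite totally ordered alphabet and σ : A → ℕ with σ(a) ≥ 2 for every a ∈ A. For all words U, V ∈ A*: if U ≡_{Hypo(A,2)} V and for every letter a ∈ A either |U|_a = |V|_a = 0, or |U|_a ≥ 1, |V|_a ≥ 1 and |U|_a ≡ |V|_a (mod σ(a) − 1), then U ≡_{Hypo(A,σ)} V. (That is, the hypoplactic monoid is of type 1.) -/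
/-- The defining relations of the σ-hypoplactic monoid: the Knuth relations
`acb = cab` (for `a ≤ b < c`) and `bac = bca` (for `a < b ≤ c`), the quartic
relations `cadb = acbd` (for `a ≤ b < c ≤ d`) and `bdca = dbac` (for `a < b ≤ c < d`),
together with `a^(σ a) = a` for every letter. -/
def hypoRel {A : Type*} [LinearOrder A] (σ : A → ℕ) (U V : FreeMonoid A) : Prop :=
  (∃ a b c : A, a ≤ b ∧ b < c ∧
    U = FreeMonoid.of a * FreeMonoid.of c * FreeMonoid.of b ∧
    V = FreeMonoid.of c * FreeMonoid.of a * FreeMonoid.of b) ∨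
  (∃ a b c : A, a < b ∧ b ≤ c ∧
    U = FreeMonoid.of b * FreeMonoid.of a * FreeMonoid.of c ∧
    V = FreeMonoid.of b * FreeMonoid.of c * FreeMonoid.of a) ∨
  (∃ a b c d : A, a ≤ b ∧ b < c ∧ c ≤ d ∧
    U = FreeMonoid.of c * FreeMonoid.of a * FreeMonoid.of d * FreeMonoid.of b ∧
    V = FreeMonoid.of a * FreeMonoid.of c * FreeMonoid.of b * FreeMonoid.of d) ∨
  (∃ a b c d : A, a < b ∧ b ≤ c ∧ c < d ∧
    U = FreeMonoid.of b * FreeMonoid.of d * FreeMonoid.of c * FreeMonoid.of a ∧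
    V = FreeMonoid.of d * FreeMonoid.of b * FreeMonoid.of a * FreeMonoid.of c) ∨
  (∃ a : A, U = FreeMonoid.of a ^ σ a ∧ V = FreeMonoid.of a)

/-- The congruence on the free monoid defining the σ-hypoplactic monoid `Hypo(A, σ)`. -/
def hypoCon {A : Type*} [LinearOrder A] (σ : A → ℕ) : Con (FreeMonoid A) :=
  conGen (hypoRel σ)

/-- A family of elements of a monoid, indexed by an alphabet, satisfying the defining relations of
the `σ`-hypoplactic monoid (the quartic relation `bdca = dbac` follows from the other ones). -/
structure IsHypoplacticFamily {A M : Type*} [LinearOrder A] [Monoid M] (σ : A → ℕ)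
    (x : A → M) : Prop where
  acb : ∀ {a b c : A}, a ≤ b → b < c → x a * x c * x b = x c * x a * x b
  bac : ∀ {a b c : A}, a < b → b ≤ c → x b * x a * x c = x b * x c * x a
  cadb : ∀ {a b c d : A}, a ≤ b → b < c → c ≤ d →
    x c * x a * x d * x b = x a * x c * x b * x d
  pow : ∀ a : A, x a ^ σ a = x a

/-- `IsBlowUp U V` says that `V` arises from `U` by replacing every occurrence of a letter by a
positive power of that letter. -/
inductive IsBlowUp {A : Type*} : List A → List A → Prop
  | nil : IsBlowUp [] []
  | cons (a : A) (n : ℕ) {U V : List A} (h : IsBlowUp U V) :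
      IsBlowUp (a :: U) (List.replicate (n + 1) a ++ V)

namespace IsBlowUp

variable {A : Type*}

theorem refl (U : List A) : IsBlowUp U U := by
  induction U with
  | nil => exact .nil
  | cons a U ih => exact .cons a 0 ih

theorem append {U V U' V' : List A} (h : IsBlowUp U U') (h' : IsBlowUp V V') :
    IsBlowUp (U ++ V) (U' ++ V') := by
  induction h with
  | nil => exact h'
  | cons a n _ ih => simpa [List.append_assoc] using IsBlowUp.cons a n ih

theorem nil_iff {V : List A} : IsBlowUp [] V ↔ V = [] :=
  ⟨fun h => by cases h; rfl, fun h => h ▸ .nil⟩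

theorem cons_iff {a : A} {U V : List A} :
    IsBlowUp (a :: U) V ↔ ∃ n W, V = List.replicate (n + 1) a ++ W ∧ IsBlowUp U W := by
  constructor
  · intro h
    cases h with
    | cons _ n h => exact ⟨n, _, rfl, h⟩
  · rintro ⟨n, W, rfl, h⟩
    exact .cons a n h

theorem exists_of_append {U V W : List A} (h : IsBlowUp (U ++ V) W) :
    ∃ U' V', W = U' ++ V' ∧ IsBlowUp U U' ∧ IsBlowUp V V' := by
  induction U generalizing W with
  | nil => exact ⟨[], W, rfl, .nil, h⟩
  | cons a U ih =>
    obtain ⟨n, X, rfl, hX⟩ := cons_iff.1 (List.cons_append ▸ h)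
    obtain ⟨U', V', rfl, hU, hV⟩ := ih hX
    exact ⟨_, V', (List.append_assoc _ _ _).symm, .cons a n hU, hV⟩

theorem exists_of_three {a b c : A} {W : List A} (h : IsBlowUp [a, b, c] W) :
    ∃ i j k, W = List.replicate (i + 1) a ++
      (List.replicate (j + 1) b ++ (List.replicate (k + 1) c ++ [])) := by
  obtain ⟨i, X, rfl, hX⟩ := cons_iff.1 h
  obtain ⟨j, Y, rfl, hY⟩ := cons_iff.1 hX
  obtain ⟨k, Z, rfl, hZ⟩ := cons_iff.1 hY
  exact ⟨i, j, k, by rw [nil_iff.1 hZ]⟩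

theorem exists_of_four {a b c d : A} {W : List A} (h : IsBlowUp [a, b, c, d] W) :
    ∃ i j k l, W = List.replicate (i + 1) a ++ (List.replicate (j + 1) b ++
      (List.replicate (k + 1) c ++ (List.replicate (l + 1) d ++ []))) := by
  obtain ⟨i, X, rfl, hX⟩ := cons_iff.1 h
  obtain ⟨j, k, l, rfl⟩ := hX.exists_of_three
  exact ⟨i, j, k, l, rfl⟩

end IsBlowUp

namespace IsHypoplacticFamily

variable {A M : Type*} [LinearOrder A] [Monoid M] {σ : A → ℕ} {x : A → M}

/-! ### Relations between powers of letters -/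

theorem pow_mul_mul (h : IsHypoplacticFamily σ x) {a b c : A} (hab : a ≤ b) (hbc : b < c)
    (i : ℕ) : x c ^ i * x a * x b = x a * x c ^ i * x b := by
  induction i with
  | zero => simp
  | succ i ih =>
    obtain _ | i := i
    · simpa using (h.acb hab hbc).symm
    · calc x c ^ (i + 1 + 1) * x a * x b = x c ^ (i + 1) * (x c * x a * x b) := by
            simp only [pow_succ, mul_assoc]
        _ = x c ^ i * (x c * x a * x c * x b) := by
            rw [← h.acb hab hbc]; simp only [pow_succ, mul_assoc]
        _ = x c ^ i * (x a * x c * x b) * x c := by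
            rw [h.cadb hab hbc le_rfl]; simp only [mul_assoc]
        _ = (x c ^ (i + 1) * x a * x b) * x c := by
            rw [h.acb hab hbc]; simp only [pow_succ, mul_assoc]
        _ = x a * x c ^ i * (x c * x b * x c) := by
            rw [ih]; simp only [pow_succ, mul_assoc]
        _ = x a * x c ^ (i + 1 + 1) * x b := by
            rw [h.bac hbc le_rfl]; simp only [pow_succ, mul_assoc]

theorem pow_mul_pow_mul (h : IsHypoplacticFamily σ x) {a b c : A} (hab : a ≤ b) (hbc : b < c)
    (i j : ℕ) : x c ^ i * x a ^ j * x b = x a ^ j * x c ^ i * x b := by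
  induction j with
  | zero => simp
  | succ j ih =>
    obtain _ | j := j
    · simpa using h.pow_mul_mul hab hbc i
    · calc x c ^ i * x a ^ (j + 1 + 1) * x b = (x c ^ i * x a * x a) * x a ^ j * x b := by
            simp only [pow_succ', mul_assoc]
        _ = x a * (x c ^ i * x a ^ (j + 1) * x b) := by
            rw [h.pow_mul_mul le_rfl (hab.trans_lt hbc)]; simp only [pow_succ', mul_assoc]
        _ = x a ^ (j + 1 + 1) * x c ^ i * x b := by
            rw [ih]; simp only [pow_succ', mul_assoc]

theorem pow_acb (h : IsHypoplacticFamily σ x) {a b c : A} (hab : a ≤ b) (hbc : b < c)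
    (i j k : ℕ) :
    x a ^ j * x c ^ i * x b ^ (k + 1) = x c ^ i * x a ^ j * x b ^ (k + 1) := by
  rw [pow_succ', ← mul_assoc, ← mul_assoc, h.pow_mul_pow_mul hab hbc]

theorem mul_mul_pow (h : IsHypoplacticFamily σ x) {a b c : A} (hab : a < b) (hbc : b ≤ c)
    (i : ℕ) : x b * x c * x a ^ i = x b * x a ^ i * x c := by
  induction i with
  | zero => simp
  | succ i ih =>
    obtain _ | i := i
    · simpa using (h.bac hab hbc).symm
    · calc x b * x c * x a ^ (i + 1 + 1) = (x b * x c * x a) * x a ^ (i + 1) := by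
            simp only [pow_succ', mul_assoc]
        _ = (x b * x a * x c * x a) * x a ^ i := by
            rw [← h.bac hab hbc]; simp only [pow_succ', mul_assoc]
        _ = x a * (x b * x a * x c) * x a ^ i := by
            rw [h.cadb le_rfl hab hbc]; simp only [mul_assoc]
        _ = x a * (x b * x c * x a ^ (i + 1)) := by
            rw [h.bac hab hbc]; simp only [pow_succ', mul_assoc]
        _ = (x a * x b * x a) * x a ^ i * x c := by
            rw [ih]; simp only [pow_succ', mul_assoc]
        _ = x b * x a ^ (i + 1 + 1) * x c := by
            rw [h.acb le_rfl hab]; simp only [pow_succ', mul_assoc]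

theorem mul_pow_mul_pow (h : IsHypoplacticFamily σ x) {a b c : A} (hab : a < b) (hbc : b ≤ c)
    (i k : ℕ) : x b * x c ^ k * x a ^ i = x b * x a ^ i * x c ^ k := by
  induction k with
  | zero => simp
  | succ k ih =>
    obtain _ | k := k
    · simpa using h.mul_mul_pow hab hbc i
    · calc x b * x c ^ (k + 1 + 1) * x a ^ i = x b * x c ^ k * (x c * x c * x a ^ i) := by
            simp only [pow_succ, mul_assoc]
        _ = (x b * x c ^ (k + 1) * x a ^ i) * x c := by
            rw [h.mul_mul_pow (hab.trans_le hbc) le_rfl]; simp only [pow_succ, mul_assoc]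
        _ = x b * x a ^ i * x c ^ (k + 1 + 1) := by
            rw [ih]; simp only [pow_succ, mul_assoc]

theorem pow_bac (h : IsHypoplacticFamily σ x) {a b c : A} (hab : a < b) (hbc : b ≤ c)
    (i j k : ℕ) :
    x b ^ (j + 1) * x a ^ i * x c ^ k = x b ^ (j + 1) * x c ^ k * x a ^ i := by
  simp only [pow_succ, mul_assoc]
  rw [← mul_assoc (x b), ← h.mul_pow_mul_pow hab hbc, mul_assoc]

theorem pow_cadb (h : IsHypoplacticFamily σ x) {a b c d : A} (hab : a ≤ b) (hbc : b < c)
    (hcd : c ≤ d) (i j k l : ℕ) :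
    x c ^ (i + 1) * x a ^ (j + 1) * x d ^ (k + 1) * x b ^ (l + 1) =
      x a ^ (j + 1) * x c ^ (i + 1) * x b ^ (l + 1) * x d ^ (k + 1) := by
  have hac := hab.trans_lt hbc
  have hbd := hbc.trans_le hcd
  calc x c ^ (i + 1) * x a ^ (j + 1) * x d ^ (k + 1) * x b ^ (l + 1)
      = (x c ^ (i + 1) * x a ^ j * x a) * (x d * x d ^ k * x b ^ (l + 1)) := by
        simp only [pow_succ' (x d), pow_succ (x a), mul_assoc]
    _ = x a ^ j * x c ^ i * (x c * x a * x d * x b) * x b ^ l * x d ^ k := by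
        rw [h.pow_mul_pow_mul le_rfl hac, h.mul_pow_mul_pow hbd le_rfl]
        simp only [pow_succ (x c), pow_succ' (x b), mul_assoc]
    _ = x a ^ j * x c ^ i * (x a * x c * x b) * x d * x b ^ l * x d ^ k := by
        rw [h.cadb hab hbc hcd]; simp only [mul_assoc]
    _ = x a ^ j * (x c ^ (i + 1) * x a * x b) * x d * x b ^ l * x d ^ k := by
        rw [h.acb hab hbc]; simp only [pow_succ, mul_assoc]
    _ = x a ^ (j + 1) * x c ^ i * (x c * x b * x d) * x b ^ l * x d ^ k := by
        rw [h.pow_mul_mul hab hbc]; simp only [pow_succ, mul_assoc]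
    _ = x a ^ (j + 1) * x c ^ i * (x c * x d * x b ^ (l + 1)) * x d ^ k := by
        rw [h.bac hbc hcd]; simp only [pow_succ', mul_assoc]
    _ = _ := by
        rw [h.mul_mul_pow hbc hcd]
        simp only [pow_succ' (x d), pow_succ (x c), mul_assoc]

theorem pow_bdca (h : IsHypoplacticFamily σ x) {a b c d : A} (hab : a < b) (hbc : b ≤ c)
    (hcd : c < d) (i j k l : ℕ) :
    x b ^ (i + 1) * x d ^ j * x c ^ (k + 1) * x a ^ l =
      x d ^ j * x b ^ (i + 1) * x a ^ l * x c ^ (k + 1) := by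
  rw [h.pow_acb hbc hcd]
  simp only [mul_assoc]
  rw [← mul_assoc (x b ^ (i + 1)), ← h.pow_bac hab hbc, mul_assoc]

theorem pow_add_period (h : IsHypoplacticFamily σ x) (hσ : ∀ a, 2 ≤ σ a) (a : A) (n : ℕ) :
    x a ^ (n + 1 + (σ a - 1)) = x a ^ (n + 1) := by
  rw [show n + 1 + (σ a - 1) = n + σ a by have := hσ a; omega, pow_add, h.pow, pow_succ]

theorem pow_eq_pow_of_modEq (h : IsHypoplacticFamily σ x) (hσ : ∀ a, 2 ≤ σ a) (a : A)
    {m n : ℕ} (hmn : m + 1 ≡ n + 1 [MOD σ a - 1]) : x a ^ (m + 1) = x a ^ (n + 1) := by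
  have key : ∀ n k, x a ^ (n + 1 + (σ a - 1) * k) = x a ^ (n + 1) := by
    intro n k
    induction k with
    | zero => simp
    | succ k ih =>
      rw [show n + 1 + (σ a - 1) * (k + 1) = n + (σ a - 1) * k + 1 + (σ a - 1) by ring,
        h.pow_add_period hσ, ← ih]
      congr 1; ring
  rcases le_total (m + 1) (n + 1) with hle | hle
  · obtain ⟨k, hk⟩ := (Nat.modEq_iff_dvd' hle).1 hmn
    rw [← key m k, ← hk]; congr 1; omega
  · obtain ⟨k, hk⟩ := (Nat.modEq_iff_dvd' hle).1 hmn.symm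
    rw [← key n k, ← hk]; congr 1; omega

/-! ### Moving powers of a letter across a word -/

/-- Every word is weakly increasing or equivalent to a rearrangement starting with a strict
descent. -/
theorem isChain_or_exists_descent (h : IsHypoplacticFamily σ x) (v : List A) :
    v.IsChain (· ≤ ·) ∨ ∃ y z r, z < y ∧ v.Perm (y :: z :: r) ∧
      (v.map x).prod = x y * x z * (r.map x).prod := by
  induction v with
  | nil => exact .inl .nil
  | cons b v ih =>
    rcases ih with hv | ⟨y, z, r, hzy, hp, he⟩
    · cases v with
      | nil => exact .inl (.singleton b)
      | cons c v =>
        rcases le_or_gt b c with hbc | hbc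
        · exact .inl (.cons_cons hbc hv)
        · exact .inr ⟨b, c, v, hbc, .refl _, by simp [mul_assoc]⟩
    · right
      rw [List.map_cons, List.prod_cons, he]
      rcases lt_or_ge y b with hyb | hyb
      · exact ⟨b, y, z :: r, hyb, hp.cons b, by simp [mul_assoc]⟩
      rcases le_or_gt b z with hbz | hbz
      · refine ⟨y, b, z :: r, hbz.trans_lt hzy, (hp.cons b).trans (.swap _ _ _), ?_⟩
        rw [List.map_cons, List.prod_cons, ← mul_assoc, ← mul_assoc, h.acb hbz hzy]
        simp only [mul_assoc]
      · refine ⟨b, z, y :: r, hbz, (hp.cons b).trans ((List.Perm.swap _ _ _).cons b), ?_⟩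
        rw [List.map_cons, List.prod_cons, ← mul_assoc, ← mul_assoc, ← h.bac hbz hyb]
        simp only [mul_assoc]

theorem shift_low (h : IsHypoplacticFamily σ x) (hσ : ∀ a, 2 ≤ σ a) {a b : A} (hb : b < a)
    {m : M} (hm : ∀ p q, x a ^ (p + 1) * m * x a ^ (q + 1) = x a * m * x a ^ (p + q + 1))
    (p q : ℕ) :
    x a ^ (p + 1) * (x b * m) * x a ^ (q + 1) = x a * (x b * m) * x a ^ (p + q + 1) := by
  have comm : ∀ n, x a ^ (n + 1) * x b = x a * x b * x a ^ n := fun n => by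
    have := h.mul_pow_mul_pow hb le_rfl 1 n
    rwa [pow_one, ← pow_succ'] at this
  have key : ∀ p q, x a ^ (p + 1 + 1) * (x b * m) * x a ^ (q + 1) =
      x a ^ 2 * (x b * m) * x a ^ (p + q + 1) := by
    intro p q
    calc x a ^ (p + 1 + 1) * (x b * m) * x a ^ (q + 1)
        = (x a ^ (p + 1 + 1) * x b) * m * x a ^ (q + 1) := by simp only [mul_assoc]
      _ = x a * x b * (x a ^ (p + 1) * m * x a ^ (q + 1)) := by
          rw [comm]; simp only [mul_assoc]
      _ = (x a * x b * x a ^ 1) * m * x a ^ (p + q + 1) := by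
          rw [hm]; simp only [pow_one, mul_assoc]
      _ = _ := by rw [← comm]; simp only [mul_assoc]
  have one : ∀ q, x a * (x b * m) * x a ^ (q + 1) =
      x a ^ 2 * (x b * m) * x a ^ (q + (σ a - 1)) := by
    intro q
    have h1 := h.pow_add_period hσ a 0
    obtain ⟨t, ht⟩ : ∃ t, σ a - 1 = t + 1 := ⟨σ a - 2, by have := hσ a; omega⟩
    rw [zero_add, pow_one] at h1
    conv_lhs => enter [1, 1]; rw [← h1]
    rw [show 1 + (σ a - 1) = t + 1 + 1 by omega, key, show t + q + 1 = q + (σ a - 1) by omega]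
  obtain _ | p := p
  · simp
  · rw [key, one, show p + 1 + q + (σ a - 1) = p + q + 1 + (σ a - 1) by omega,
      h.pow_add_period hσ]

theorem shift_high (h : IsHypoplacticFamily σ x) (hσ : ∀ a, 2 ≤ σ a) {a b : A} (hb : a < b)
    {m : M} (hm : ∀ p q, x a ^ (p + 1) * m * x a ^ (q + 1) = x a * m * x a ^ (p + q + 1))
    (p q : ℕ) :
    x a ^ (p + 1) * (m * x b) * x a ^ (q + 1) = x a * (m * x b) * x a ^ (p + q + 1) := by
  have comm : ∀ n, x b * x a ^ (n + 1) = x a ^ n * x b * x a := fun n => by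
    have := h.pow_mul_pow_mul le_rfl hb 1 n
    rw [pow_one] at this
    rw [← this, pow_succ, mul_assoc]
  have key : ∀ q, x a ^ (p + 1) * (m * x b) * x a ^ (q + 1 + 1) =
      x a * (m * x b) * x a ^ (p + (q + 1) + 1) := by
    intro q
    calc x a ^ (p + 1) * (m * x b) * x a ^ (q + 1 + 1)
        = x a ^ (p + 1) * m * (x b * x a ^ (q + 1 + 1)) := by simp only [mul_assoc]
      _ = (x a ^ (p + 1) * m * x a ^ (q + 1)) * x b * x a := by
          rw [comm]; simp only [mul_assoc]
      _ = x a * m * (x a ^ (p + (q + 1)) * x b * x a) := by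
          rw [hm]; simp only [mul_assoc, add_assoc]
      _ = _ := by rw [← comm]; simp only [mul_assoc]
  obtain _ | q := q
  · obtain ⟨t, ht⟩ : ∃ t, σ a - 1 = t + 1 := ⟨σ a - 2, by have := hσ a; omega⟩
    have h1 := key t
    rwa [show t + 1 + 1 = 0 + 1 + (σ a - 1) by omega, h.pow_add_period hσ,
      show p + (t + 1) + 1 = p + 0 + 1 + (σ a - 1) by omega, h.pow_add_period hσ] at h1
  · exact key q

theorem shift (h : IsHypoplacticFamily σ x) (hσ : ∀ a, 2 ≤ σ a) (a : A) (v : List A) (p q : ℕ) :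
    x a ^ (p + 1) * (v.map x).prod * x a ^ (q + 1) =
      x a * (v.map x).prod * x a ^ (p + q + 1) := by
  induction hn : v.length using Nat.strong_induction_on generalizing v p q with
  | _ n ih =>
  subst hn
  have low : ∀ {b : A} {r : List A}, b < a → r.length < v.length →
      ∀ p q, x a ^ (p + 1) * (x b * (r.map x).prod) * x a ^ (q + 1) =
        x a * (x b * (r.map x).prod) * x a ^ (p + q + 1) := fun hb hr =>
    h.shift_low hσ hb fun p q => ih _ hr _ p q rfl
  by_cases hav : a ∈ v
  · obtain ⟨v₁, v₂, rfl⟩ := List.append_of_mem hav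
    have h₁ := ih v₁.length (by simp) v₁ p 0 rfl
    have h₂ := ih v₂.length (by simp; omega) v₂ p q rfl
    simp only [zero_add, add_zero, pow_one] at h₁
    calc _ = (x a ^ (p + 1) * (v₁.map x).prod * x a) * (v₂.map x).prod * x a ^ (q + 1) := by
          simp [mul_assoc]
      _ = x a * (v₁.map x).prod * (x a ^ (p + 1) * (v₂.map x).prod * x a ^ (q + 1)) := by
          rw [h₁]; simp only [mul_assoc]
      _ = _ := by rw [h₂]; simp [mul_assoc]
  rcases h.isChain_or_exists_descent v with hv | ⟨y, z, r, hzy, hp, he⟩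
  · rcases List.eq_nil_or_concat v with rfl | ⟨u, b, rfl⟩
    · simp only [List.map_nil, List.prod_nil, mul_one, ← pow_add, ← pow_succ']
      congr 1; omega
    rcases lt_trichotomy a b with hb | rfl | hb
    · simpa [mul_assoc] using
        h.shift_high hσ hb (fun p q => ih u.length (by simp) u p q rfl) p q
    · simp at hav
    · cases u with
      | nil => simpa using low (r := []) hb (by simp) p q
      | cons c u =>
        have hcb : c ≤ b := by
          rw [List.isChain_iff_pairwise] at hv
          simpa using (List.pairwise_cons.1 hv).1 b (by simp)
        simpa using low (r := u ++ [b]) (hcb.trans_lt hb) (by simp) p q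
  · have hlen := hp.length_eq
    have hy : y ≠ a := fun e => hav (hp.mem_iff.2 (by simp [e]))
    have hz : z ≠ a := fun e => hav (hp.mem_iff.2 (by simp [e]))
    simp only [List.length_cons] at hlen
    rw [he]
    rcases hy.lt_or_gt with hy | hy
    · simpa [mul_assoc] using low (r := z :: r) hy (by simp; omega) p q
    rcases hz.lt_or_gt with hz | hz
    · have e : ∀ n, x a ^ (n + 1) * (x y * x z * (r.map x).prod) =
          x a ^ (n + 1) * (x z * ((y :: r).map x).prod) := fun n => by
        have := h.pow_bac hz hy.le 1 n 1
        simp only [pow_one] at this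
        simp only [List.map_cons, List.prod_cons, ← mul_assoc]
        rw [this]
      have e₀ := e 0
      simp only [zero_add, pow_one] at e₀
      rw [e, e₀]
      exact low hz (by simp; omega) p q
    · have e : ∀ n, x a ^ n * (x y * x z * (r.map x).prod) =
          x y * (x a ^ n * ((z :: r).map x).prod) := fun n => by
        have := h.pow_mul_pow_mul hz.le hzy 1 n
        simp only [pow_one] at this
        simp only [List.map_cons, List.prod_cons, ← mul_assoc]
        rw [this]
      have e₁ := e 1
      rw [pow_one] at e₁
      rw [e, e₁, mul_assoc (x y), mul_assoc (x y),
        ih (z :: r).length (by simp; omega) (z :: r) p q rfl]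

theorem shift_modEq (h : IsHypoplacticFamily σ x) (hσ : ∀ a, 2 ≤ σ a) (a : A) (v : List A)
    {p q p' q' : ℕ} (hpq : p + q + 1 ≡ p' + q' + 1 [MOD σ a - 1]) :
    x a ^ (p + 1) * (v.map x).prod * x a ^ (q + 1) =
      x a ^ (p' + 1) * (v.map x).prod * x a ^ (q' + 1) := by
  rw [h.shift hσ, h.shift hσ, h.pow_eq_pow_of_modEq hσ a hpq]

/-! ### Blow-ups of a word -/

theorem exists_blowUp_shift (h : IsHypoplacticFamily σ x) (hσ : ∀ a, 2 ≤ σ a) {a : A}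
    {U U' : List A} (hU : IsBlowUp U U') (ha : a ∈ U) (m n : ℕ) (v : List A) :
    ∃ V, IsBlowUp U V ∧
      x a ^ (m + 1) * (v.map x).prod * (U'.map x).prod =
        x a ^ (n + 1) * (v.map x).prod * (V.map x).prod ∧
      ∀ c, (List.replicate (m + 1) a ++ U').count c ≡
        (List.replicate (n + 1) a ++ V).count c [MOD σ c - 1] := by
  induction hU generalizing v with
  | nil => simp at ha
  | @cons b i U U' hU ih =>
    by_cases hab : a = b
    · subst hab
      obtain ⟨t, ht⟩ : ∃ t, σ a - 1 = t + 1 := ⟨σ a - 2, by have := hσ a; omega⟩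
      have hmod : ∀ e, m + i + e ≡ n + (i + m + n * t) + e [MOD σ a - 1] := fun e => by
        rw [show n + (i + m + n * t) + e = m + i + e + (σ a - 1) * n by rw [ht]; ring]
        simp [Nat.ModEq]
      refine ⟨_, .cons a (i + m + n * t) hU, ?_, fun c => ?_⟩
      · have := h.shift_modEq hσ a v (hmod 1)
        simp only [List.map_append, List.map_replicate, List.prod_append, List.prod_replicate,
          ← mul_assoc]
        rw [this]
      · by_cases hc : c = a
        · subst hc
          simpa [add_assoc, add_comm, add_left_comm] using hmod (2 + U'.count c)
        · simp [List.count_replicate, Ne.symm hc, Nat.ModEq.refl]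
    · obtain ⟨V, hV, he, hc⟩ := ih (by simpa [hab] using ha) (v ++ List.replicate (i + 1) b)
      refine ⟨_, .cons b i hV, ?_, fun c => ?_⟩
      · simpa [mul_assoc] using he
      · have := (hc c).add_left ((List.replicate (i + 1) b).count c)
        simp only [List.count_append] at this ⊢
        convert this using 1 <;> omega

/-- Two blow-ups of the same word whose contents agree modulo the periods are equivalent. -/
theorem prod_eq_of_isBlowUp (h : IsHypoplacticFamily σ x) (hσ : ∀ a, 2 ≤ σ a)
    {W U V : List A} (hU : IsBlowUp W U) (hV : IsBlowUp W V)
    (hc : ∀ c, U.count c ≡ V.count c [MOD σ c - 1]) :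
    (U.map x).prod = (V.map x).prod := by
  induction W generalizing U V with
  | nil => rw [IsBlowUp.nil_iff.1 hU, IsBlowUp.nil_iff.1 hV]
  | cons a W ih =>
    obtain ⟨m, U', rfl, hU'⟩ := IsBlowUp.cons_iff.1 hU
    obtain ⟨n, V', rfl, hV'⟩ := IsBlowUp.cons_iff.1 hV
    by_cases ha : a ∈ W
    · obtain ⟨U₁, hU₁, he, hc₁⟩ := h.exists_blowUp_shift hσ hU' ha m n []
      have := ih hU₁ hV' fun c => by
        have := (hc₁ c).symm.trans (hc c)
        simp only [List.count_append] at this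
        exact Nat.ModEq.add_left_cancel' _ this
      simp only [List.map_nil, List.prod_nil, mul_one] at he
      simp [he, this]
    · have notMem : ∀ {W V : List A}, IsBlowUp W V → a ∉ W → V.count a = 0 := by
        intro W V hV
        induction hV with
        | nil => simp
        | cons b n _ ih =>
          intro hb
          simp only [List.mem_cons, not_or] at hb
          simp [List.count_replicate, Ne.symm hb.1, ih hb.2]
      have hmn : m + 1 ≡ n + 1 [MOD σ a - 1] := by
        simpa [notMem hU' ha, notMem hV' ha] using hc a
      have := ih hU' hV' fun c => by
        by_cases hca : c = a
        · rw [hca, notMem hU' ha, notMem hV' ha]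
        · simpa [List.count_replicate, Ne.symm hca] using hc c
      simp [this, h.pow_eq_pow_of_modEq hσ a hmn]

/-- Every blow-up of `U` is equivalent to a blow-up of `V` with the same content modulo the
periods. -/
def Transfers (σ : A → ℕ) (x : A → M) (U V : List A) : Prop :=
  ∀ U', IsBlowUp U U' → ∃ V', IsBlowUp V V' ∧
    (∀ c, U'.count c ≡ V'.count c [MOD σ c - 1]) ∧ (U'.map x).prod = (V'.map x).prod

theorem Transfers.trans {U V W : List A} (h : Transfers σ x U V) (h' : Transfers σ x V W) :
    Transfers σ x U W := by
  intro U' hU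
  obtain ⟨V', hV, hc, he⟩ := h U' hU
  obtain ⟨W', hW, hc', he'⟩ := h' V' hV
  exact ⟨W', hW, fun c => (hc c).trans (hc' c), he.trans he'⟩

theorem Transfers.append {U V U' V' : List A} (h : Transfers σ x U V)
    (h' : Transfers σ x U' V') : Transfers σ x (U ++ U') (V ++ V') := by
  intro W hW
  obtain ⟨U₁, U₂, rfl, h₁, h₂⟩ := hW.exists_of_append
  obtain ⟨V₁, hV₁, hc₁, he₁⟩ := h U₁ h₁
  obtain ⟨V₂, hV₂, hc₂, he₂⟩ := h' U₂ h₂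
  refine ⟨V₁ ++ V₂, hV₁.append hV₂, fun c => ?_, by simp [he₁, he₂]⟩
  simpa using (hc₁ c).add (hc₂ c)

/-- The congruence of words whose blow-ups correspond to each other. -/
def transferCon (σ : A → ℕ) (x : A → M) : Con (FreeMonoid A) where
  r U V := Transfers σ x U.toList V.toList ∧ Transfers σ x V.toList U.toList
  iseqv :=
    { refl := fun _ => ⟨fun U' h => ⟨U', h, fun _ => rfl, rfl⟩,
        fun U' h => ⟨U', h, fun _ => rfl, rfl⟩⟩
      symm := fun h => ⟨h.2, h.1⟩
      trans := fun h h' => ⟨h.1.trans h'.1, h'.2.trans h.2⟩ }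
  mul' h h' := ⟨h.1.append h'.1, h.2.append h'.2⟩

theorem hypoCon_two_le_transferCon (h : IsHypoplacticFamily σ x) (hσ : ∀ a, 2 ≤ σ a) :
    hypoCon (fun _ : A => 2) ≤ transferCon σ x := by
  refine Con.conGen_le.2 ?_
  rintro U V (⟨a, b, c, hab, hbc, rfl, rfl⟩ | ⟨a, b, c, hab, hbc, rfl, rfl⟩ |
    ⟨a, b, c, d, hab, hbc, hcd, rfl, rfl⟩ | ⟨a, b, c, d, hab, hbc, hcd, rfl, rfl⟩ | ⟨a, rfl, rfl⟩)
  · refine ⟨fun W hW => ?_, fun W hW => ?_⟩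
    · obtain ⟨i, k, j, rfl⟩ := hW.exists_of_three
      refine ⟨_, .cons c k (.cons a i (.cons b j .nil)), fun e => congrArg (· % _) ?_, ?_⟩
      · simp only [List.count_append]; omega
      · simpa [mul_assoc] using h.pow_acb hab hbc (k + 1) (i + 1) j
    · obtain ⟨k, i, j, rfl⟩ := hW.exists_of_three
      refine ⟨_, .cons a i (.cons c k (.cons b j .nil)), fun e => congrArg (· % _) ?_, ?_⟩
      · simp only [List.count_append]; omega
      · simpa [mul_assoc] using (h.pow_acb hab hbc (k + 1) (i + 1) j).symm
  · refine ⟨fun W hW => ?_, fun W hW => ?_⟩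
    · obtain ⟨j, i, k, rfl⟩ := hW.exists_of_three
      refine ⟨_, .cons b j (.cons c k (.cons a i .nil)), fun e => congrArg (· % _) ?_, ?_⟩
      · simp only [List.count_append]; omega
      · simpa [mul_assoc] using h.pow_bac hab hbc (i + 1) j (k + 1)
    · obtain ⟨j, k, i, rfl⟩ := hW.exists_of_three
      refine ⟨_, .cons b j (.cons a i (.cons c k .nil)), fun e => congrArg (· % _) ?_, ?_⟩
      · simp only [List.count_append]; omega
      · simpa [mul_assoc] using (h.pow_bac hab hbc (i + 1) j (k + 1)).symm
  · refine ⟨fun W hW => ?_, fun W hW => ?_⟩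
    · obtain ⟨k, i, l, j, rfl⟩ := hW.exists_of_four
      refine ⟨_, .cons a i (.cons c k (.cons b j (.cons d l .nil))),
        fun e => congrArg (· % _) ?_, ?_⟩
      · simp only [List.count_append]; omega
      · simpa [mul_assoc] using h.pow_cadb hab hbc hcd k i l j
    · obtain ⟨i, k, j, l, rfl⟩ := hW.exists_of_four
      refine ⟨_, .cons c k (.cons a i (.cons d l (.cons b j .nil))),
        fun e => congrArg (· % _) ?_, ?_⟩
      · simp only [List.count_append]; omega
      · simpa [mul_assoc] using (h.pow_cadb hab hbc hcd k i l j).symm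
  · refine ⟨fun W hW => ?_, fun W hW => ?_⟩
    · obtain ⟨j, l, k, i, rfl⟩ := hW.exists_of_four
      refine ⟨_, .cons d l (.cons b j (.cons a i (.cons c k .nil))),
        fun e => congrArg (· % _) ?_, ?_⟩
      · simp only [List.count_append]; omega
      · simpa [mul_assoc] using h.pow_bdca hab hbc hcd j (l + 1) k (i + 1)
    · obtain ⟨l, j, i, k, rfl⟩ := hW.exists_of_four
      refine ⟨_, .cons b j (.cons d l (.cons c k (.cons a i .nil))),
        fun e => congrArg (· % _) ?_, ?_⟩
      · simp only [List.count_append]; omega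
      · simpa [mul_assoc] using (h.pow_bdca hab hbc hcd j (l + 1) k (i + 1)).symm
  · refine ⟨fun W hW => ?_, fun W hW => ?_⟩
    · obtain ⟨m, X, rfl, hX⟩ := IsBlowUp.cons_iff.1 hW
      obtain ⟨n, Y, rfl, hY⟩ := IsBlowUp.cons_iff.1 hX
      rw [IsBlowUp.nil_iff.1 hY]
      refine ⟨_, .cons a (m + n + 1) .nil, fun e => congrArg (· % _) ?_, ?_⟩
      · simp only [List.count_append, List.count_replicate]; split <;> omega
      · simp only [List.map_append, List.map_replicate, List.prod_append, List.prod_replicate,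
          ← pow_add, List.map_nil, List.prod_nil, mul_one]
        congr 1; omega
    · obtain ⟨n, X, rfl, hX⟩ := IsBlowUp.cons_iff.1 hW
      rw [IsBlowUp.nil_iff.1 hX]
      obtain ⟨t, ht⟩ : ∃ t, σ a - 1 = t + 1 := ⟨σ a - 2, by have := hσ a; omega⟩
      refine ⟨_, .cons a n (.cons a t .nil), fun e => ?_, ?_⟩
      · by_cases hea : e = a
        · subst hea
          simp [Nat.ModEq, ← ht]
        · simp [List.count_replicate, Ne.symm hea, Nat.ModEq.refl]
      · have := h.pow_add_period hσ a n
        rw [ht] at this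
        simp [this]

end IsHypoplacticFamily

theorem isHypoplacticFamily_hypoCon {A : Type*} [LinearOrder A] (σ : A → ℕ) :
    IsHypoplacticFamily σ fun a => (hypoCon σ).mk' (FreeMonoid.of a) where
  acb hab hbc := by
    simp only [← map_mul]
    exact (Con.eq _).2 (.of _ _ (.inl ⟨_, _, _, hab, hbc, rfl, rfl⟩))
  bac hab hbc := by
    simp only [← map_mul]
    exact (Con.eq _).2 (.of _ _ (.inr (.inl ⟨_, _, _, hab, hbc, rfl, rfl⟩)))
  cadb hab hbc hcd := by
    simp only [← map_mul]
    exact (Con.eq _).2 (.of _ _ (.inr (.inr (.inl ⟨_, _, _, _, hab, hbc, hcd, rfl, rfl⟩))))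
  pow a := by
    rw [← map_pow]
    exact (Con.eq _).2 (.of _ _ (.inr (.inr (.inr (.inr ⟨a, rfl, rfl⟩)))))

/-- The hypoplactic monoid is of type 1: if two words are equivalent in `Hypo(A,2)`
and, for every letter `a`, either `a` occurs in neither word, or it occurs in both
and its numbers of occurrences agree modulo `σ(a) - 1`, then the words are
equivalent in `Hypo(A,σ)`. -/
theorem hypoplactic_type1 {A : Type*} [LinearOrder A] [Fintype A]
    (σ : A → ℕ) (hσ : ∀ a : A, 2 ≤ σ a) (U V : FreeMonoid A)
    (h2 : hypoCon (fun _ : A => 2) U V)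
    (hev : ∀ a : A,
      (U.toList.count a = 0 ∧ V.toList.count a = 0) ∨
      (1 ≤ U.toList.count a ∧ 1 ≤ V.toList.count a ∧
        U.toList.count a % (σ a - 1) = V.toList.count a % (σ a - 1))) :
    hypoCon σ U V := by
  have h := isHypoplacticFamily_hypoCon σ
  obtain ⟨V', hV', hc, he⟩ :=
    (h.hypoCon_two_le_transferCon hσ h2).1 U.toList (.refl _)
  have hV := h.prod_eq_of_isBlowUp hσ hV' (.refl _) fun c => by
    refine (hc c).symm.trans ?_
    rcases hev c with ⟨h₁, h₂⟩ | ⟨_, _, h₃⟩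
    · rw [h₁, h₂]
    · exact h₃
  have hprod : ∀ W : FreeMonoid A,
      (W.toList.map fun a => (hypoCon σ).mk' (FreeMonoid.of a)).prod = (hypoCon σ).mk' W := by
    intro W
    induction W using FreeMonoid.inductionOn' with
    | one => simp
    | of_mul a W ih => rw [FreeMonoid.toList_of_mul, List.map_cons, List.prod_cons, ih, map_mul]
  rw [← Con.eq]
  exact (hprod U).symm.trans ((he.trans hV).trans (hprod V))
end

section
/- Let A be a finite totally ordered alphabet and σ : A → ℕ with σ(a) ≥ 2 for every a ∈ A. Then the σ-plactic monoid Plax(A,σ) is finite and its cardinality is |Plax(A,σ)| = Σ_{B ⊆ A} ( Bell(|B|) · Π_{b ∈ B} (σ(b) − 1) ), where the sum is over all subsets B of A. -/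
/-- The `k`-th Bell number: the number of equivalence relations on a `k`-element set. -/
noncomputable def bellNumber (k : ℕ) : ℕ :=
  Nat.card {r : Fin k → Fin k → Prop // Equivalence r}

theorem pow_mul_mul_comm_of_sandwich {M : Type*} [Monoid M] {c V : M}
    (h : c * c * V * c = c * V * c * c) (m : ℕ) :
    c ^ (m + 1) * V * c = c * V * c ^ (m + 1) := by
  induction m with
  | zero => simp
  | succ m ih =>
    calc c ^ (m + 1 + 1) * V * c = c * (c ^ (m + 1) * V * c) := by
          rw [pow_succ' c (m + 1)]; simp only [mul_assoc]
      _ = c * c * V * c * c ^ m := by rw [ih, pow_succ']; simp only [mul_assoc]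
      _ = c * V * c ^ (m + 1 + 1) := by
          rw [h, pow_succ' c (m + 1), pow_succ' c m]; simp only [mul_assoc]

theorem sandwich_left_mul {M : Type*} [Monoid M] {c x V : M} {n : ℕ} (hc : c ^ (n + 2) = c)
    (hx : c * c * x = c * x * c) (h : c * c * V * c = c * V * c * c) :
    c * c * (x * V) * c = c * (x * V) * c * c := by
  have hcx : Commute c (c * x) := by
    simpa only [Commute, SemiconjBy, mul_assoc] using hx
  have hcx' : c * x = c * x * c ^ (n + 1) := by
    rw [← (hcx.pow_left (n + 1)).eq, ← mul_assoc, ← pow_succ, hc]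
  calc c * c * (x * V) * c = c * c * x * (V * c) := by simp only [mul_assoc]
    _ = c * x * (c * V * c ^ (n + 2)) := by rw [hx, hc]; simp only [mul_assoc]
    _ = c * x * (c * V * c ^ (n + 1)) * c := by rw [pow_succ c (n + 1)]; simp only [mul_assoc]
    _ = c * x * c ^ (n + 1) * (V * c * c) := by
      rw [← pow_mul_mul_comm_of_sandwich h]; simp only [mul_assoc]
    _ = c * (x * V) * c * c := by rw [← hcx']; simp only [mul_assoc]

theorem sandwich_mul_right {M : Type*} [Monoid M] {c x V : M} {n : ℕ} (hc : c ^ (n + 2) = c)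
    (hx : c * x * c = x * c * c) (h : c * c * V * c = c * V * c * c) :
    c * c * (V * x) * c = c * (V * x) * c * c := by
  have := sandwich_left_mul (M := Mᵐᵒᵖ) (c := .op c) (x := .op x) (V := .op V) (n := n)
    (by rw [← MulOpposite.op_pow, hc])
    (by simpa only [← MulOpposite.op_mul, mul_assoc, MulOpposite.op_inj] using hx.symm)
    (by simpa only [← MulOpposite.op_mul, mul_assoc, MulOpposite.op_inj] using h.symm)
  simpa only [← MulOpposite.op_mul, mul_assoc, MulOpposite.op_inj] using this.symm

/-- The images `f a` of the letters in a monoid satisfy the defining relations of the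
σ-plactic monoid. -/
structure IsPlaxMap {A M : Type*} [LinearOrder A] [Monoid M] (σ : A → ℕ) (f : A → M) : Prop where
  two_le : ∀ a, 2 ≤ σ a
  knuth_left : ∀ {a b c}, a ≤ b → b < c → f a * f c * f b = f c * f a * f b
  knuth_right : ∀ {a b c}, a < b → b ≤ c → f b * f a * f c = f b * f c * f a
  pow_eq : ∀ a, f a ^ σ a = f a

namespace IsPlaxMap

variable {A M : Type*} [LinearOrder A] [Monoid M] {σ : A → ℕ} {f : A → M}

theorem op (h : IsPlaxMap σ f) :
    IsPlaxMap (A := Aᵒᵈ) (M := Mᵐᵒᵖ) (fun a => σ (OrderDual.ofDual a))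
      (fun a => .op (f (OrderDual.ofDual a))) where
  two_le a := h.two_le _
  knuth_left {a b c} hab hbc := by
    have := h.knuth_right (a := OrderDual.ofDual c) (b := OrderDual.ofDual b)
      (c := OrderDual.ofDual a) hbc hab
    simpa only [← MulOpposite.op_mul, mul_assoc, MulOpposite.op_inj] using this
  knuth_right {a b c} hab hbc := by
    have := h.knuth_left (a := OrderDual.ofDual c) (b := OrderDual.ofDual b)
      (c := OrderDual.ofDual a) hbc hab
    simpa only [← MulOpposite.op_mul, mul_assoc, MulOpposite.op_inj] using this
  pow_eq a := by rw [← MulOpposite.op_pow, h.pow_eq]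

theorem pow_sub_add (h : IsPlaxMap σ f) (a : A) : f a ^ (σ a - 2 + 2) = f a := by
  rw [Nat.sub_add_cancel (h.two_le a), h.pow_eq]

/-- Up to the Knuth relations, a word is weakly increasing or starts with a descent. -/
theorem sorted_or_descent (h : IsPlaxMap σ f) (v : List A) :
    v.Pairwise (· ≤ ·) ∨ ∃ d y w, y < d ∧ (d :: y :: w).length = v.length ∧
      ((d :: y :: w).map f).prod = (v.map f).prod := by
  induction v with
  | nil => simp
  | cons x v ih =>
    rcases ih with hs | ⟨d, y, w, hyd, hlen, hprod⟩
    · cases v with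
      | nil => simp
      | cons z v =>
        by_cases hxz : x ≤ z
        · left
          rw [List.pairwise_cons]
          refine ⟨fun a ha => ?_, hs⟩
          rcases List.mem_cons.1 ha with rfl | ha
          · exact hxz
          · exact hxz.trans ((List.pairwise_cons.1 hs).1 a ha)
        · exact .inr ⟨x, z, v, not_le.1 hxz, rfl, rfl⟩
    · right
      simp only [List.map_cons, List.prod_cons, List.length_cons] at hprod hlen ⊢
      by_cases hdx : d < x
      · exact ⟨x, d, y :: w, hdx, by simpa using hlen, by simp [hprod]⟩
      · by_cases hxy : x ≤ y
        · refine ⟨d, x, y :: w, hxy.trans_lt hyd, by simpa using hlen, ?_⟩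
          have := h.knuth_left hxy hyd
          simp only [List.map_cons, List.prod_cons]
          rw [← hprod]
          simp only [← mul_assoc]
          rw [this]
        · refine ⟨x, y, d :: w, not_le.1 hxy, by simpa using hlen, ?_⟩
          have := h.knuth_right (not_le.1 hxy) (not_lt.1 hdx)
          simp only [List.map_cons, List.prod_cons]
          rw [← hprod]
          simp only [← mul_assoc]
          rw [this]

theorem sandwich_of_head_le (h : IsPlaxMap σ f) {c x : A} {V : M} (hx : x ≤ c)
    (hV : f c * f c * V * f c = f c * V * f c * f c) :
    f c * f c * (f x * V) * f c = f c * (f x * V) * f c * f c := by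
  refine sandwich_left_mul (h.pow_sub_add c) ?_ hV
  rcases hx.eq_or_lt with rfl | hx
  · rfl
  · exact (h.knuth_right hx le_rfl).symm

theorem sandwich_of_le_last (h : IsPlaxMap σ f) {c x : A} {V : M} (hx : c ≤ x)
    (hV : f c * f c * V * f c = f c * V * f c * f c) :
    f c * f c * (V * f x) * f c = f c * (V * f x) * f c * f c := by
  refine sandwich_mul_right (h.pow_sub_add c) ?_ hV
  rcases hx.eq_or_lt with rfl | hx
  · rfl
  · exact h.knuth_left le_rfl hx

/-- A repeated letter can be moved between two occurrences of that letter. -/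
theorem sandwich (h : IsPlaxMap σ f) (c : A) (v : List A) :
    f c * f c * (v.map f).prod * f c = f c * (v.map f).prod * f c * f c := by
  induction hn : v.length using Nat.strong_induction_on generalizing v with
  | _ n ih =>
  subst hn
  rcases h.sorted_or_descent v with hs | ⟨d, y, w, hyd, hlen, hprod⟩
  · rcases List.eq_nil_or_concat v with rfl | ⟨u, x, rfl⟩
    · simp
    · rw [List.concat_eq_append] at *
      rcases le_total c x with hx | hx
      · rw [List.map_append, List.prod_append]
        simpa using h.sandwich_of_le_last hx (ih u.length (by simp) u rfl)
      · obtain ⟨z, t, hzt⟩ : ∃ z t, u ++ [x] = z :: t := by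
          cases u with
          | nil => exact ⟨x, [], rfl⟩
          | cons z t => exact ⟨z, t ++ [x], rfl⟩
        have hz : z ≤ x := by
          have hmem : x ∈ z :: t := by rw [← hzt]; simp
          rw [hzt] at hs
          rcases List.mem_cons.1 hmem with rfl | hmem
          · exact le_rfl
          · exact (List.pairwise_cons.1 hs).1 x hmem
        rw [hzt] at ih ⊢
        simpa using h.sandwich_of_head_le (hz.trans hx) (ih t.length (by simp) t rfl)
  · rw [← hprod]
    simp only [← hlen] at ih
    simp only [List.map_cons, List.prod_cons]
    rcases le_or_gt d c with hdc | hcd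
    · simpa using h.sandwich_of_head_le hdc (ih _ (by simp) (y :: w) rfl)
    rcases lt_trichotomy y c with hyc | rfl | hcy
    · have := h.sandwich_of_head_le hyc.le (ih _ (by simp) (d :: w) rfl)
      have hk := h.knuth_right hyc hcd.le
      simp only [List.map_cons, List.prod_cons] at this
      have e : f c * (f d * (f y * (w.map f).prod)) = f c * (f y * (f d * (w.map f).prod)) := by
        simp only [← mul_assoc]; rw [hk]
      rw [mul_assoc (f c) (f c), e, ← mul_assoc, this]
    · have hk := h.knuth_left le_rfl hcd
      have hw := ih _ (by simp) w rfl
      have e : f y * (f d * (f y * (w.map f).prod)) = f d * f y * (f y * (w.map f).prod) := by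
        simp only [← mul_assoc]; rw [hk]
      have e' : f y * (f d * f y) = f d * f y * f y := by rw [← mul_assoc, hk]
      rw [mul_assoc (f y) (f y), e]
      calc _ = f y * (f d * f y) * f y * (w.map f).prod * f y := by simp only [mul_assoc]
        _ = f d * (f y * (f y * f y * (w.map f).prod * f y)) := by rw [e']; simp only [mul_assoc]
        _ = _ := by rw [hw]; simp only [mul_assoc]
    · have hk := h.knuth_left hcy.le hyd
      have hw := ih _ (by simp) (y :: w) rfl
      simp only [List.map_cons, List.prod_cons] at hw
      have e : f c * (f d * (f y * (w.map f).prod)) = f d * f c * (f y * (w.map f).prod) := by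
        simp only [← mul_assoc]; rw [hk]
      calc _ = f c * (f c * (f d * (f y * (w.map f).prod))) * f c := by simp only [mul_assoc]
        _ = f c * f d * f c * f y * (w.map f).prod * f c := by rw [e]; simp only [mul_assoc]
        _ = f d * (f c * f c * (f y * (w.map f).prod) * f c) := by
          rw [h.knuth_left le_rfl hcd]
          simp only [mul_assoc]
        _ = f d * f c * (f y * (w.map f).prod) * f c * f c := by rw [hw]; simp only [mul_assoc]
        _ = _ := by rw [← e]

end IsPlaxMap

/-- The weakly increasing word with support in `B` in which each `b ∈ B` occurs `m b` times. -/
def rowWord {A : Type*} [LinearOrder A] (B : Finset A) (m : A → ℕ) : List A :=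
  B.sort.flatMap fun b => List.replicate (m b) b

theorem mem_rowWord {A : Type*} [LinearOrder A] {B : Finset A} {m : A → ℕ}
    (hm : ∀ b ∈ B, m b ≠ 0) {x : A} : x ∈ rowWord B m ↔ x ∈ B := by
  simp only [rowWord, List.mem_flatMap, Finset.mem_sort, List.mem_replicate]
  constructor
  · rintro ⟨b, hb, -, rfl⟩
    exact hb
  · exact fun hx => ⟨x, hx, hm x hx, rfl⟩

theorem toFinset_rowWord {A : Type*} [LinearOrder A] {B : Finset A} {m : A → ℕ}
    (hm : ∀ b ∈ B, m b ≠ 0) : (rowWord B m).toFinset = B := by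
  ext x
  rw [List.mem_toFinset, mem_rowWord hm]

theorem count_rowWord {A : Type*} [LinearOrder A] {B : Finset A} {m : A → ℕ} {x : A} (hx : x ∈ B) :
    (rowWord B m).count x = m x := by
  rw [rowWord, List.count_flatMap]
  obtain ⟨s, t, hst⟩ := List.append_of_mem ((Finset.mem_sort (· ≤ ·)).2 hx)
  have hnd := Finset.sort_nodup B (· ≤ ·)
  rw [hst] at hnd ⊢
  have hs : x ∉ s := fun h => (List.nodup_append.1 hnd).2.2 x h x (by simp) rfl
  have ht : x ∉ t := (List.nodup_cons.1 (List.nodup_append.1 hnd).2.1).1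
  have key : ∀ r : List A, x ∉ r →
      (r.map (List.count x ∘ fun b => List.replicate (m b) b)).sum = 0 := by
    intro r hr
    rw [List.sum_eq_zero]
    intro n hn
    obtain ⟨b, hb, rfl⟩ := List.mem_map.1 hn
    have : b ≠ x := fun e => hr (e ▸ hb)
    simp [List.count_replicate, this]
  simp [key s hs, key t ht]

theorem pairwise_rowWord {A : Type*} [LinearOrder A] (B : Finset A) (m : A → ℕ) :
    (rowWord B m).Pairwise (· ≤ ·) := by
  rw [rowWord, List.pairwise_flatMap]
  refine ⟨fun a _ => List.pairwise_replicate.2 (.inr le_rfl), ?_⟩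
  refine (Finset.pairwise_sort B (· ≤ ·)).imp fun {a b} hab x hx y hy => ?_
  rw [List.eq_of_mem_replicate hx, List.eq_of_mem_replicate hy]
  exact hab

theorem eq_rowWord_of_pairwise {A : Type*} [LinearOrder A] {l : List A}
    (hl : l.Pairwise (· ≤ ·)) : l = rowWord l.toFinset (l.count ·) := by
  refine List.Perm.eq_of_pairwise' hl (pairwise_rowWord _ _) ?_
  rw [List.perm_iff_count]
  intro x
  by_cases hx : x ∈ l
  · rw [count_rowWord (by simpa using hx)]
  · rw [List.count_eq_zero_of_not_mem hx, List.count_eq_zero_of_not_mem]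
    rw [mem_rowWord]
    · simpa using hx
    · intro b hb
      simpa [List.count_eq_zero] using hb

/-- Equality of the exponents `m` and `n` in a monogenic monoid with the relation `a ^ s = a`. -/
def ExpEq (s m n : ℕ) : Prop := (m = 0 ↔ n = 0) ∧ m ≡ n [MOD s - 1]

namespace ExpEq

theorem refl (s m : ℕ) : ExpEq s m m := ⟨Iff.rfl, rfl⟩

theorem symm {s m n : ℕ} (h : ExpEq s m n) : ExpEq s n m := ⟨h.1.symm, h.2.symm⟩

theorem trans {s m n k : ℕ} (h : ExpEq s m n) (h' : ExpEq s n k) : ExpEq s m k :=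
  ⟨h.1.trans h'.1, h.2.trans h'.2⟩

theorem add {s m n m' n' : ℕ} (h : ExpEq s m n) (h' : ExpEq s m' n') :
    ExpEq s (m + m') (n + n') := by
  refine ⟨?_, h.2.add h'.2⟩
  rw [Nat.add_eq_zero_iff, Nat.add_eq_zero_iff, h.1, h'.1]

end ExpEq

namespace IsPlaxMap

variable {A M : Type*} [LinearOrder A] [Monoid M] {σ : A → ℕ} {f : A → M}

theorem pow_eq_pow (h : IsPlaxMap σ f) {a : A} {m n : ℕ} (hmn : ExpEq (σ a) m n) :
    f a ^ m = f a ^ n := by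
  wlog hle : m ≤ n generalizing m n
  · exact (this hmn.symm (le_of_not_ge hle)).symm
  obtain ⟨q, hq⟩ := (Nat.modEq_iff_dvd' hle).1 hmn.2
  obtain ⟨h0, -⟩ := hmn
  rcases m with _ | m
  · rw [h0.1 rfl]
  have hn : n = m + 1 + (σ a - 1) * q := by omega
  subst hn
  clear hle hq h0
  have h2 := h.two_le a
  have hs : f a * f a ^ (σ a - 1) = f a := by
    rw [← pow_succ', Nat.sub_add_cancel (by omega), h.pow_eq]
  induction q with
  | zero => simp
  | succ q ih =>
    have e : m + 1 + (σ a - 1) * (q + 1) = m + (σ a - 1) * q + (1 + (σ a - 1)) := by ring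
    rw [ih, e, pow_add _ _ (1 + _), pow_add _ 1, pow_one, hs, ← pow_succ]
    congr 1
    ring

theorem prod_rowWord (f : A → M) (B : Finset A) (m : A → ℕ) :
    ((rowWord B m).map f).prod = (B.sort.map fun b => f b ^ m b).prod := by
  rw [rowWord]
  induction B.sort with
  | nil => rfl
  | cons b l ih => simp [ih]

theorem prod_rowWord_congr (h : IsPlaxMap σ f) {B : Finset A} {m n : A → ℕ}
    (hmn : ∀ b ∈ B, ExpEq (σ b) (m b) (n b)) :
    ((rowWord B m).map f).prod = ((rowWord B n).map f).prod := by
  rw [prod_rowWord, prod_rowWord]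
  congr 1
  exact List.map_congr_left fun b hb => h.pow_eq_pow (hmn b (by simpa using hb))

theorem row_mul_of_lt (h : IsPlaxMap σ f) {x y : A} {l : List A} (hl : (y :: l).Pairwise (· ≤ ·))
    (hxy : x < y) : f y * (l.map f).prod * f x = f y * f x * (l.map f).prod := by
  induction l generalizing y with
  | nil => simp
  | cons z l ih =>
    have hyz : y ≤ z := (List.pairwise_cons.1 hl).1 z (by simp)
    have := ih (List.pairwise_cons.1 hl).2 (hxy.trans_le hyz)
    rw [List.map_cons, List.prod_cons, mul_assoc (f y), this, ← mul_assoc, ← mul_assoc, ← mul_assoc,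
      h.knuth_right hxy hyz]

theorem row_mul_mul_of_le (h : IsPlaxMap σ f) {x y : A} {l : List A} (hl : l.Pairwise (· ≤ ·))
    (hlx : ∀ z ∈ l, z ≤ x) (hxy : x < y) :
    (l.map f).prod * f y * f x = f y * (l.map f).prod * f x := by
  induction l with
  | nil => simp
  | cons p l ih =>
    have ih := ih (List.pairwise_cons.1 hl).2 fun z hz => hlx z (by simp [hz])
    have hk : f p * f y * ((l.map f).prod * f x) = f y * f p * ((l.map f).prod * f x) := by
      cases l with
      | nil => simpa using h.knuth_left (hlx p (by simp)) hxy
      | cons q l =>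
        have := h.knuth_left (a := p) (b := q) (c := y) ((List.pairwise_cons.1 hl).1 q (by simp))
          ((hlx q (by simp)).trans_lt hxy)
        simp only [List.map_cons, List.prod_cons, ← mul_assoc]
        rw [this]
    calc _ = f p * ((l.map f).prod * f y * f x) := by simp [mul_assoc]
      _ = f p * f y * ((l.map f).prod * f x) := by rw [ih]; simp only [mul_assoc]
      _ = _ := by rw [hk]; simp [mul_assoc]

/-- Row insertion of `x`, bumping one copy of `y` out of the row and keeping the others. -/
theorem row_mul (h : IsPlaxMap σ f) {x y : A} {l₁ l₂ : List A}
    (hl : (l₁ ++ y :: l₂).Pairwise (· ≤ ·)) (hx : ∀ z ∈ l₁, z ≤ x) (hxy : x < y) :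
    ((l₁ ++ y :: l₂).map f).prod * f x =
      f y * ((l₁ ++ x :: (List.replicate (σ y - 1) y ++ l₂)).map f).prod := by
  obtain ⟨hl₁, hl₂, -⟩ := List.pairwise_append.1 hl
  have hp : f y * f y ^ (σ y - 1) = f y := by
    rw [← pow_succ', Nat.sub_add_cancel (by have := h.two_le y; omega), h.pow_eq]
  have hs : (y :: (List.replicate (σ y - 1) y ++ l₂)).Pairwise (· ≤ ·) := by
    have hy := (List.pairwise_cons.1 hl₂).1
    refine List.pairwise_cons.2 ⟨fun z hz => ?_, List.pairwise_append.2
      ⟨List.pairwise_replicate.2 (.inr le_rfl), (List.pairwise_cons.1 hl₂).2, fun a ha b hb => ?_⟩⟩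
    · rcases List.mem_append.1 hz with hz | hz
      · exact (List.eq_of_mem_replicate hz).ge
      · exact hy z hz
    · rw [List.eq_of_mem_replicate ha]
      exact hy b hb
  have h₁ := h.row_mul_of_lt hs hxy
  have h₂ := h.row_mul_mul_of_le hl₁ hx hxy
  simp only [List.map_append, List.map_cons, List.prod_append, List.prod_cons,
    List.map_replicate, List.prod_replicate] at h₁ h₂ ⊢
  calc _ = (l₁.map f).prod * (f y * f y ^ (σ y - 1) * (l₂.map f).prod * f x) := by
        rw [hp]; simp only [mul_assoc]
    _ = (l₁.map f).prod * (f y * (f y ^ (σ y - 1) * (l₂.map f).prod) * f x) := by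
        simp only [mul_assoc]
    _ = (l₁.map f).prod * f y * f x * (f y ^ (σ y - 1) * (l₂.map f).prod) := by
        rw [h₁]; simp only [mul_assoc]
    _ = _ := by rw [h₂]; simp only [mul_assoc]

/-- Every word can be rewritten so that it ends in a row containing all of its letters, no letter
before that row being minimal. -/
theorem exists_row (h : IsPlaxMap σ f) (w : List A) :
    ∃ v l : List A, l.Pairwise (· ≤ ·) ∧ l.toFinset = w.toFinset ∧
      (∀ y ∈ v, y ∈ w ∧ ∃ b ∈ w, b < y) ∧ (w.map f).prod = (v.map f).prod * (l.map f).prod := by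
  induction w using List.reverseRecOn with
  | nil => exact ⟨[], [], by simp⟩
  | append_singleton w x ih =>
    obtain ⟨v, l, hl, hlw, hv, hprod⟩ := ih
    have hmem : ∀ z, z ∈ l ↔ z ∈ w := fun z => by
      rw [← List.mem_toFinset, hlw, List.mem_toFinset]
    have hv' : ∀ y ∈ v, y ∈ w ++ [x] ∧ ∃ b ∈ w ++ [x], b < y := fun y hy =>
      ⟨by simp [(hv y hy).1], (hv y hy).2.imp fun b hb => ⟨by simp [hb.1], hb.2⟩⟩
    have hsplit := List.takeWhile_append_dropWhile (p := (· ≤ x)) (l := l)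
    have htake : ∀ z ∈ l.takeWhile (· ≤ x), z ≤ x := fun z hz => by
      simpa using List.mem_takeWhile_imp hz
    rcases hd : l.dropWhile (· ≤ x) with _ | ⟨y, l₂⟩
    · rw [hd, List.append_nil] at hsplit
      refine ⟨v, l ++ [x], ?_, ?_, hv', by simp [hprod, mul_assoc]⟩
      · refine List.pairwise_append.2 ⟨hl, by simp, fun a ha b hb => ?_⟩
        rw [List.mem_singleton.1 hb]
        exact htake a (by rwa [hsplit])
      · simp [hlw]
    · set l₁ := l.takeWhile (· ≤ x)
      rw [hd] at hsplit
      have hxy : x < y := by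
        have := List.head?_dropWhile_not (· ≤ x) l
        rw [hd] at this
        simpa using this
      rw [← hsplit] at hl hmem
      have hins := h.row_mul hl htake hxy
      have h2 := h.two_le y
      obtain ⟨hl₁, hl₂, hl₁₂⟩ := List.pairwise_append.1 hl
      obtain ⟨hyl, hl₂⟩ := List.pairwise_cons.1 hl₂
      refine ⟨v ++ [y], l₁ ++ x :: (List.replicate (σ y - 1) y ++ l₂), ?_, ?_, ?_, ?_⟩
      · simp only [List.pairwise_append, List.pairwise_cons, List.mem_append, List.mem_cons,
          List.mem_replicate, List.pairwise_replicate]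
        grind
      · ext z
        have := hmem z
        simp only [List.mem_toFinset, List.mem_append, List.mem_cons, List.mem_replicate] at this ⊢
        have : σ y - 1 ≠ 0 := by omega
        grind
      · intro z hz
        rcases List.mem_append.1 hz with hz | hz
        · exact hv' z hz
        · obtain rfl := List.mem_singleton.1 hz
          exact ⟨by simp [← hmem], x, by simp, hxy⟩
      · rw [List.map_append, List.prod_append, hprod, ← hsplit, mul_assoc]
        simp only [List.map_cons, List.map_nil, List.prod_singleton]
        rw [hins]
        simp [mul_assoc]

theorem pow_mul_mul_comm (h : IsPlaxMap σ f) {a b c : A} (hab : a ≤ b) (hbc : b < c) (j : ℕ) :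
    f c ^ (j + 3) * f a * f b = f a * f c ^ (j + 3) * f b := by
  have hca : Commute (f c) (f c * f a) := by
    have := h.knuth_right (hab.trans_lt hbc) (le_refl c)
    simpa only [Commute, SemiconjBy, mul_assoc] using this.symm
  have hcb : Commute (f c) (f c * f b) := by
    have := h.knuth_right hbc (le_refl c)
    simpa only [Commute, SemiconjBy, mul_assoc] using this.symm
  have hk := h.knuth_left hab hbc
  have hs := h.sandwich c [a, b]
  simp only [List.map_cons, List.map_nil, List.prod_cons, List.prod_nil, mul_one] at hs
  calc f c ^ (j + 3) * f a * f b = f c ^ (j + 2) * (f c * f a) * f b := by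
        rw [pow_succ]; simp only [mul_assoc]
    _ = f c * f a * (f c ^ (j + 1) * (f c * f b)) := by
        rw [(hca.pow_left (j + 2)).eq, pow_succ]; simp only [mul_assoc]
    _ = f c * (f a * f c * f b) * f c ^ (j + 1) := by
        rw [(hcb.pow_left (j + 1)).eq]; simp only [mul_assoc]
    _ = f c * f c * (f a * f b) * f c * f c ^ j := by
        rw [hk, pow_succ']; simp only [mul_assoc]
    _ = f c * f a * f b * f c ^ (j + 2) := by
        rw [hs, pow_succ' _ (j + 1), pow_succ' _ j]; simp only [mul_assoc]
    _ = f a * (f c * f b * f c ^ (j + 2)) := by rw [← hk]; simp only [mul_assoc]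
    _ = f a * f c ^ (j + 3) * f b := by
        rw [← (hcb.pow_left (j + 2)).eq, pow_succ _ (j + 2)]; simp only [mul_assoc]

theorem pow_mul_pow_mul_comm (h : IsPlaxMap σ f) {a b c : A} (hab : a ≤ b) (hbc : b < c)
    (i j : ℕ) : f c ^ (j + 3) * f a ^ i * f b = f a ^ i * f c ^ (j + 3) * f b := by
  induction i with
  | zero => simp
  | succ i ih =>
    cases i with
    | zero => simpa using h.pow_mul_mul_comm hab hbc j
    | succ i =>
      calc _ = f c ^ (j + 3) * f a * f a * (f a ^ i * f b) := by
            rw [pow_succ' (f a) (i + 1), pow_succ' (f a) i]; simp only [mul_assoc]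
        _ = f a * (f c ^ (j + 3) * f a ^ (i + 1) * f b) := by
            rw [h.pow_mul_mul_comm le_rfl (hab.trans_lt hbc), pow_succ' (f a) i]
            simp only [mul_assoc]
        _ = _ := by rw [ih, pow_succ' _ (i + 1)]; simp only [mul_assoc]

theorem pow_mul_pow_mul_pow_comm (h : IsPlaxMap σ f) {a b c : A} (hab : a ≤ b) (hbc : b < c)
    {i j k : ℕ} (hj : j ≠ 0) (hk : k ≠ 0) :
    f a ^ i * f c ^ j * f b ^ k = f c ^ j * f a ^ i * f b ^ k := by
  obtain ⟨k, rfl⟩ := Nat.exists_eq_succ_of_ne_zero hk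
  have hσ := h.two_le c
  have e : f c ^ j = f c ^ (j + 3 * (σ c - 2) + 3) := h.pow_eq_pow (a := c) <| by
    refine ⟨by omega, (Nat.modEq_iff_dvd' (by omega)).2 ⟨3, by omega⟩⟩
  rw [e, pow_succ' (f b), ← mul_assoc, ← mul_assoc, h.pow_mul_pow_mul_comm hab hbc]

/-- The idempotents `f a ^ (σ a - 1)` satisfy the relations of the stylic monoid. -/
theorem idempotents (h : IsPlaxMap σ f) :
    IsPlaxMap (fun _ => 2) fun a => f a ^ (σ a - 1) := by
  have hσ a : σ a - 1 ≠ 0 := by have := h.two_le a; omega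
  refine ⟨fun _ => le_rfl, fun hab hbc => ?_, fun {a b c} hab hbc => ?_, fun a => ?_⟩
  · exact h.pow_mul_pow_mul_pow_comm hab hbc (hσ _) (hσ _)
  · have := h.op.pow_mul_pow_mul_pow_comm (a := OrderDual.toDual c) (b := OrderDual.toDual b)
      (c := OrderDual.toDual a) hbc hab (i := σ c - 1) (hσ a) (hσ b)
    simpa only [← MulOpposite.op_mul, ← MulOpposite.op_pow, mul_assoc, MulOpposite.op_inj,
      OrderDual.ofDual_toDual] using this
  · rw [← pow_mul]
    refine h.pow_eq_pow ⟨by have := hσ a; omega, ?_⟩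
    exact (Nat.modEq_iff_dvd' (by omega)).2 ⟨1, by omega⟩ |>.symm

theorem mul_row_update (h : IsPlaxMap σ f) {B : Finset A} {m : A → ℕ} {x : A} (hx : x ∈ B)
    (hm : m x ≠ 0) (v : List A) :
    f x * (v.map f).prod * ((rowWord B m).map f).prod =
      f x ^ (σ x - 1) * (v.map f).prod *
        ((rowWord B (Function.update m x (m x + 1))).map f).prod := by
  obtain ⟨s, t, hst⟩ := List.append_of_mem ((Finset.mem_sort (· ≤ ·)).2 hx)
  have hnd := Finset.sort_nodup B (· ≤ ·)
  rw [rowWord, rowWord, hst]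
  rw [hst] at hnd
  have hs : ∀ b ∈ s, b ≠ x := fun b h => (List.nodup_append.1 hnd).2.2 b h x (by simp)
  have ht : ∀ b ∈ t, b ≠ x := fun b h e =>
    (List.nodup_cons.1 (List.nodup_append.1 hnd).2.1).1 (e ▸ h)
  have key : ∀ r : List A, (∀ b ∈ r, b ≠ x) →
      (r.flatMap fun b => List.replicate (Function.update m x (m x + 1) b) b) =
        r.flatMap fun b => List.replicate (m b) b := fun r hr => by
    refine List.flatMap_congr fun b hb => ?_
    rw [Function.update_of_ne (hr b hb)]
  have hsw := pow_mul_mul_comm_of_sandwich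
    (h.sandwich x (v ++ s.flatMap fun b => List.replicate (m b) b)) (σ x - 2)
  obtain ⟨n, hn⟩ := Nat.exists_eq_succ_of_ne_zero hm
  have h2 := h.two_le x
  have hp := h.pow_sub_add x
  simp only [List.flatMap_append, List.flatMap_cons, key s hs, key t ht, Function.update_self,
    List.map_append, List.prod_append, List.map_replicate, List.prod_replicate] at hsw ⊢
  set S := ((s.flatMap fun b => List.replicate (m b) b).map f).prod
  set T := ((t.flatMap fun b => List.replicate (m b) b).map f).prod
  have e : σ x - 1 = σ x - 2 + 1 := by omega
  rw [e, hn]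
  symm
  calc _ = f x ^ (σ x - 2 + 1) * ((v.map f).prod * S) * f x * f x ^ (n + 1) * T := by
        rw [Nat.succ_eq_add_one, pow_succ' _ (n + 1)]; simp only [mul_assoc]
    _ = f x * ((v.map f).prod * S) * f x ^ (σ x - 2 + 2) * f x ^ n * T := by
        rw [hsw, pow_succ' _ n, pow_succ _ (σ x - 2 + 1)]; simp only [mul_assoc]
    _ = _ := by rw [hp, Nat.succ_eq_add_one, pow_succ' _ n]; simp only [mul_assoc]

theorem mul_row (h : IsPlaxMap σ f) {B : Finset A} {m : A → ℕ} (hm : ∀ b ∈ B, m b ≠ 0)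
    {v : List A} (hv : ∀ y ∈ v, y ∈ B) :
    (v.map f).prod * ((rowWord B m).map f).prod =
      (v.map fun a => f a ^ (σ a - 1)).prod *
        ((rowWord B fun b => v.count b + m b).map f).prod := by
  induction v generalizing m with
  | nil => simp
  | cons x v ih =>
    have hx : x ∈ B := hv x (by simp)
    rw [List.map_cons, List.prod_cons, h.mul_row_update hx (hm x hx), mul_assoc,
      ih _ fun y hy => hv y (by simp [hy])]
    · rw [List.map_cons, List.prod_cons, mul_assoc]
      congr 4
      refine congrArg (rowWord B) (funext fun b => ?_)
      by_cases hb : b = x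
      · subst hb
        simp [Nat.add_right_comm, Nat.add_assoc]
      · rw [Function.update_of_ne hb, List.count_cons_of_ne (Ne.symm hb)]
    · intro b hb
      by_cases hbx : b = x
      · simp [hbx]
      · simpa [hbx] using hm b hb

end IsPlaxMap

section Descents

variable {A : Type*} (ν : A → ℕ)

/-- The effect of prepending the letter `x` on the function giving, for each `t`, the maximal
length of a strictly decreasing subsequence with letters in `[y, t)`. -/
def prependLetter (y : ℕ) (x : A) (L : ℕ → ℕ) (t : ℕ) : ℕ :=
  if y ≤ ν x ∧ ν x < t then max (L t) (L (ν x) + 1) else L t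

/-- The effect of prepending the word `w`, see `prependLetter`. -/
def prependWord (y : ℕ) (w : List A) (L : ℕ → ℕ) : ℕ → ℕ :=
  w.foldr (prependLetter ν y) L

/-- The maximal length of a strictly decreasing subsequence of `w` with letters in `[y, t)`. -/
def descLength (w : List A) (y t : ℕ) : ℕ := prependWord ν y w 0 t

variable {ν}

theorem monotone_prependLetter {y : ℕ} {x : A} {L : ℕ → ℕ} (hL : Monotone L) :
    Monotone (prependLetter ν y x L) := by
  intro s t hst
  have := hL hst
  unfold prependLetter
  split_ifs with h₁ h₂
  · omega
  · omega
  · omega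
  · omega

theorem monotone_prependWord {y : ℕ} {w : List A} {L : ℕ → ℕ} (hL : Monotone L) :
    Monotone (prependWord ν y w L) := by
  induction w with
  | nil => exact hL
  | cons x w ih => exact monotone_prependLetter ih

theorem prependWord_append (y : ℕ) (u v : List A) (L : ℕ → ℕ) :
    prependWord ν y (u ++ v) L = prependWord ν y u (prependWord ν y v L) :=
  List.foldr_append

theorem prependWord_knuth_left [LinearOrder A] (hν : StrictMono ν) {a b c : A} (hab : a ≤ b)
    (hbc : b < c) (y : ℕ) {L : ℕ → ℕ} (hL : Monotone L) :
    prependWord ν y [a, c, b] L = prependWord ν y [c, a, b] L := by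
  have h₁ := hν.monotone hab
  have h₂ := hν hbc
  have h₃ := hL h₁
  have h₄ := hL h₂.le
  funext t
  simp only [prependWord, List.foldr_cons, List.foldr_nil, prependLetter]
  grind

theorem prependWord_knuth_right [LinearOrder A] (hν : StrictMono ν) {a b c : A} (hab : a < b)
    (hbc : b ≤ c) (y : ℕ) (L : ℕ → ℕ) :
    prependWord ν y [b, a, c] L = prependWord ν y [b, c, a] L := by
  have h₁ := hν hab
  have h₂ := hν.monotone hbc
  funext t
  simp only [prependWord, List.foldr_cons, List.foldr_nil, prependLetter]
  grind

theorem prependWord_replicate (a : A) (y : ℕ) (L : ℕ → ℕ) (n : ℕ) :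
    prependWord ν y (List.replicate (n + 1) a) L = prependWord ν y [a] L := by
  induction n with
  | zero => rfl
  | succ n ih =>
    rw [List.replicate_succ]
    change prependLetter ν y a (prependWord ν y (List.replicate (n + 1) a) L) = _
    rw [ih]
    funext t
    simp only [prependWord, List.foldr_cons, List.foldr_nil, prependLetter]
    grind

theorem prependWord_congr {y y' : ℕ} {w : List A} (h : ∀ x ∈ w, y ≤ ν x ↔ y' ≤ ν x)
    (L : ℕ → ℕ) : prependWord ν y w L = prependWord ν y' w L := by
  induction w with
  | nil => rfl
  | cons x w ih =>
    have ih := ih fun z hz => h z (by simp [hz])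
    have hx := h x (by simp)
    simp only [prependWord, List.foldr_cons] at ih ⊢
    rw [ih]
    funext t
    simp only [prependLetter, hx]

theorem descLength_eq_zero_iff {w : List A} {y t : ℕ} :
    descLength ν w y t = 0 ↔ ∀ x ∈ w, ¬(y ≤ ν x ∧ ν x < t) := by
  induction w with
  | nil => simp [descLength, prependWord]
  | cons x w ih =>
    simp only [descLength, prependWord, List.foldr_cons, prependLetter] at ih ⊢
    split_ifs with h
    · simp [h]
    · rw [ih, List.forall_mem_cons]
      exact ⟨fun hw => ⟨h, hw⟩, fun hw => hw.2⟩

theorem mem_iff_descLength_ne_zero (hν : Function.Injective ν) {w : List A} {x : A} :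
    x ∈ w ↔ descLength ν w (ν x) (ν x + 1) ≠ 0 := by
  rw [Ne, descLength_eq_zero_iff]
  push Not
  refine ⟨fun h => ⟨x, h, le_rfl, by omega⟩, ?_⟩
  rintro ⟨z, hz, h₁, h₂⟩
  rwa [hν (show ν x = ν z by omega)]

theorem prependWord_zero_of_pairwise [LinearOrder A] (hν : StrictMono ν) {l : List A}
    (hl : l.Pairwise (· ≤ ·)) (y t : ℕ) :
    prependWord ν y l 0 t = if ∃ z ∈ l, y ≤ ν z ∧ ν z < t then 1 else 0 := by
  induction l generalizing t with
  | nil => simp [prependWord]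
  | cons x l ih =>
    have ih := ih (List.pairwise_cons.1 hl).2
    have hx : prependWord ν y l 0 (ν x) = 0 := by
      rw [ih, if_neg]
      rintro ⟨z, hz, -, h⟩
      have := hν.monotone ((List.pairwise_cons.1 hl).1 z hz)
      omega
    change prependLetter ν y x (prependWord ν y l 0) t = _
    simp only [prependLetter, hx, ih, List.exists_mem_cons_iff]
    by_cases h₁ : y ≤ ν x ∧ ν x < t
    · rw [if_pos h₁, if_pos (Or.inl h₁)]
      split_ifs <;> rfl
    · rw [if_neg h₁]
      exact if_congr (or_iff_right h₁).symm rfl rfl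

theorem descLength_append_row [LinearOrder A] (hν : StrictMono ν) {v l : List A}
    (hl : l.Pairwise (· ≤ ·)) {b : A} (hb : b ∈ l) (t : ℕ) :
    descLength ν (v ++ l) (ν b) t = if ν b < t then descLength ν v (ν b + 1) t + 1 else 0 := by
  rw [descLength, prependWord_append]
  induction v generalizing t with
  | nil =>
    change prependWord ν (ν b) l 0 t = if ν b < t then 0 + 1 else 0
    rw [prependWord_zero_of_pairwise hν hl]
    refine if_congr ⟨?_, fun h => ⟨b, hb, le_rfl, h⟩⟩ rfl rfl
    rintro ⟨z, -, h₁, h₂⟩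
    omega
  | cons x v ih =>
    change prependLetter ν (ν b) x (prependWord ν (ν b) v (prependWord ν (ν b) l 0)) t =
      if ν b < t then prependLetter ν (ν b + 1) x (descLength ν v (ν b + 1)) t + 1 else 0
    simp only [prependLetter, ih]
    grind

/-- The data `descLength` of `v ++ l` determine those of `v` if `l` is a row containing all letters
of `v`, none of them as its least letter. -/
theorem descLength_eq_of_append_row [LinearOrder A] (hν : StrictMono ν) {v l v' l' : List A}
    (hl : l.Pairwise (· ≤ ·)) (hl' : l'.Pairwise (· ≤ ·)) (hll : l.toFinset = l'.toFinset)
    (hv : ∀ y ∈ v, y ∈ l ∧ ∃ b ∈ l, b < y) (hv' : ∀ y ∈ v', y ∈ l' ∧ ∃ b ∈ l', b < y)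
    (h : descLength ν (v ++ l) = descLength ν (v' ++ l')) :
    descLength ν v = descLength ν v' := by
  have hmem : ∀ x, x ∈ l ↔ x ∈ l' := fun x => by
    rw [← List.mem_toFinset, hll, List.mem_toFinset]
  have key : ∀ b ∈ l, ∀ t, descLength ν v (ν b + 1) t = descLength ν v' (ν b + 1) t := by
    intro b hb t
    have := congrFun (congrFun h (ν b)) t
    rw [descLength_append_row hν hl hb, descLength_append_row hν hl' ((hmem b).1 hb)] at this
    split_ifs at this with hbt
    · omega
    · rw [descLength_eq_zero_iff.2, descLength_eq_zero_iff.2] <;> intros <;> omega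
  funext y t
  rcases l.toFinset.eq_empty_or_nonempty with he | hne
  · have h₁ : l = [] := List.toFinset_eq_empty_iff l |>.1 he
    have h₂ : v = [] := List.eq_nil_iff_forall_not_mem.2 fun y hy => by
      have := (hv y hy).1
      simp [h₁] at this
    have h₃ : v' = [] := List.eq_nil_iff_forall_not_mem.2 fun y hy => by
      have := (hmem y).2 (hv' y hy).1
      simp [h₁] at this
    rw [h₂, h₃]
  obtain ⟨b, hb, hby⟩ : ∃ b ∈ l, ∀ u : List A, (∀ x ∈ u, x ∈ l ∧ ∃ a ∈ l, a < x) →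
      ∀ x ∈ u, y ≤ ν x ↔ ν b + 1 ≤ ν x := by
    rcases (l.toFinset.filter fun a => ν a < y).eq_empty_or_nonempty with he | hne'
    · refine ⟨l.toFinset.min' hne, by simpa using l.toFinset.min'_mem hne, fun u hu x hx => ?_⟩
      obtain ⟨hxl, a, ha, hax⟩ := hu x hx
      have h₁ : ¬ ν x < y := fun h => by
        have : x ∈ l.toFinset.filter fun a => ν a < y := by simp [hxl, h]
        simp [he] at this
      have h₂ := hν ((l.toFinset.min'_le a (by simpa using ha)).trans_lt hax)
      omega
    · have hm := Finset.max'_mem _ hne'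
      set b := (l.toFinset.filter fun a => ν a < y).max' hne'
      simp only [Finset.mem_filter, List.mem_toFinset] at hm
      refine ⟨b, hm.1, fun u hu x hx => ?_⟩
      constructor
      · intro h
        omega
      · intro h
        by_contra hc
        have hle : x ≤ b := Finset.le_max' _ _ (by simp [(hu x hx).1, not_le.1 hc])
        have := hν.monotone hle
        omega
  have hv'' : ∀ x ∈ v', x ∈ l ∧ ∃ a ∈ l, a < x := by simpa only [hmem] using hv'
  rw [descLength, descLength, prependWord_congr (hby v hv), prependWord_congr (hby v' hv'')]
  exact key b hb t

end Descents

section Quotient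

theorem toList_of_pow {A : Type*} (a : A) (n : ℕ) : (FreeMonoid.of a ^ n).toList = List.replicate n a := by
  induction n with
  | zero => rfl
  | succ n ih => rw [pow_succ', FreeMonoid.toList_mul, ih, FreeMonoid.toList_of]; rfl

variable {A : Type*} [LinearOrder A] {σ : A → ℕ}

/-- The class of a word in the σ-plactic monoid. -/
def plaxMk (σ : A → ℕ) (w : List A) : (plaxCon σ).Quotient :=
  ((FreeMonoid.ofList w : FreeMonoid A) : (plaxCon σ).Quotient)

theorem plaxMk_append (u v : List A) : plaxMk σ (u ++ v) = plaxMk σ u * plaxMk σ v := rfl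

theorem plaxMk_eq_prod (w : List A) : (w.map fun a => plaxMk σ [a]).prod = plaxMk σ w := by
  induction w with
  | nil => rfl
  | cons a w ih => rw [List.map_cons, List.prod_cons, ih]; rfl

theorem plaxMk_surjective : Function.Surjective (plaxMk σ) := fun q => by
  induction q using Con.induction_on with
  | H w => exact ⟨FreeMonoid.toList w, rfl⟩

theorem plaxMk_eq_iff {u v : List A} :
    plaxMk σ u = plaxMk σ v ↔ plaxCon σ (FreeMonoid.ofList u) (FreeMonoid.ofList v) :=
  Con.eq _

theorem isPlaxMap_plaxMk (hσ : ∀ a, 2 ≤ σ a) : IsPlaxMap σ fun a => plaxMk σ [a] where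
  two_le := hσ
  knuth_left {a b c} hab hbc :=
    (Con.eq _).2 (Con.le_conGen _ _ (.inl ⟨a, b, c, hab, hbc, rfl, rfl⟩))
  knuth_right {a b c} hab hbc :=
    (Con.eq _).2 (Con.le_conGen _ _ (.inr (.inl ⟨a, b, c, hab, hbc, rfl, rfl⟩)))
  pow_eq a := by
    refine Eq.trans ?_ ((Con.eq (plaxCon σ)).2 (Con.le_conGen _ _ (.inr (.inr ⟨a, rfl, rfl⟩))))
    exact (map_pow (plaxCon σ).mk' _ _).symm

theorem IsPlaxMap.prod_eq_of_plaxMk_eq {M : Type*} [Monoid M] {f : A → M} (h : IsPlaxMap σ f)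
    {u v : List A} (huv : plaxMk σ u = plaxMk σ v) : (u.map f).prod = (v.map f).prod := by
  have key : plaxCon σ ≤ Con.ker (FreeMonoid.lift f) := by
    refine Con.conGen_le.2 ?_
    rintro U V (⟨a, b, c, hab, hbc, rfl, rfl⟩ | ⟨a, b, c, hab, hbc, rfl, rfl⟩ | ⟨a, rfl, rfl⟩)
    · simpa [Con.ker_rel] using h.knuth_left hab hbc
    · simpa [Con.ker_rel] using h.knuth_right hab hbc
    · simpa [Con.ker_rel] using h.pow_eq a
  have := key (plaxMk_eq_iff.1 huv)
  simpa [Con.ker_rel, FreeMonoid.lift_ofList] using this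

theorem descLength_eq_of_plaxMk_eq {ν : A → ℕ} (hν : StrictMono ν) (hσ : ∀ a, 2 ≤ σ a)
    {u v : List A} (huv : plaxMk σ u = plaxMk σ v) : descLength ν u = descLength ν v := by
  let C : Con (FreeMonoid A) :=
    { r := fun u v => ∀ (y : ℕ) (L : ℕ → ℕ), Monotone L →
        prependWord ν y u.toList L = prependWord ν y v.toList L
      iseqv := ⟨fun _ _ _ _ => rfl, fun h y L hL => (h y L hL).symm,
        fun h h' y L hL => (h y L hL).trans (h' y L hL)⟩
      mul' := fun {u u' v v'} h h' y L hL => by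
        rw [FreeMonoid.toList_mul, FreeMonoid.toList_mul, prependWord_append, prependWord_append,
          h' y L hL, h y _ (monotone_prependWord hL)] }
  have key : plaxCon σ ≤ C := by
    refine Con.conGen_le.2 ?_
    rintro U V (⟨a, b, c, hab, hbc, rfl, rfl⟩ | ⟨a, b, c, hab, hbc, rfl, rfl⟩ | ⟨a, rfl, rfl⟩)
      y L hL
    · exact prependWord_knuth_left hν hab hbc y hL
    · exact prependWord_knuth_right hν hab hbc y L
    · obtain ⟨n, hn⟩ := Nat.exists_eq_succ_of_ne_zero (show σ a ≠ 0 by have := hσ a; omega)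
      change prependWord ν y (FreeMonoid.of a ^ σ a).toList L = prependWord ν y [a] L
      rw [hn, toList_of_pow, Nat.succ_eq_add_one, prependWord_replicate]
  funext y t
  exact congrFun (key (plaxMk_eq_iff.1 huv) y 0 monotone_const) t

theorem expEq_count_of_plaxMk_eq (hσ : ∀ a, 2 ≤ σ a) {u v : List A}
    (huv : plaxMk σ u = plaxMk σ v) (x : A) : ExpEq (σ x) (u.count x) (v.count x) := by
  let C : Con (FreeMonoid A) :=
    { r := fun u v => ExpEq (σ x) (u.toList.count x) (v.toList.count x)
      iseqv := ⟨fun _ => .refl _ _, fun h => h.symm, fun h h' => h.trans h'⟩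
      mul' := fun {u u' v v'} h h' => by
        rw [FreeMonoid.toList_mul, FreeMonoid.toList_mul, List.count_append, List.count_append]
        exact h.add h' }
  have key : plaxCon σ ≤ C := by
    refine Con.conGen_le.2 ?_
    rintro U V (⟨a, b, c, hab, hbc, rfl, rfl⟩ | ⟨a, b, c, hab, hbc, rfl, rfl⟩ | ⟨a, rfl, rfl⟩)
    · have : [a, c, b].count x = [c, a, b].count x := (List.Perm.swap c a [b]).count_eq x
      change ExpEq (σ x) ([a, c, b].count x) ([c, a, b].count x)
      rw [this]
      exact .refl _ _
    · have : [b, a, c].count x = [b, c, a].count x := ((List.Perm.swap c a []).cons b).count_eq x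
      change ExpEq (σ x) ([b, a, c].count x) ([b, c, a].count x)
      rw [this]
      exact .refl _ _
    · change ExpEq (σ x) ((FreeMonoid.of a ^ σ a).toList.count x) ([a].count x)
      have h2 := hσ a
      rw [toList_of_pow, List.count_replicate, List.count_singleton]
      split_ifs with hax
      · obtain rfl : a = x := by simpa using hax
        refine ⟨by omega, ?_⟩
        exact ((Nat.modEq_iff_dvd' (by omega)).2 dvd_rfl).symm
      · exact .refl _ _
  exact key (plaxMk_eq_iff.1 huv)

theorem toFinset_eq_of_plaxMk_eq (hσ : ∀ a, 2 ≤ σ a) {u v : List A}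
    (huv : plaxMk σ u = plaxMk σ v) : u.toFinset = v.toFinset := by
  ext x
  have := (expEq_count_of_plaxMk_eq hσ huv x).1
  rw [List.count_eq_zero, List.count_eq_zero] at this
  simpa using not_congr this

theorem exists_plaxMk_eq_append (hσ : ∀ a, 2 ≤ σ a) (w : List A) :
    ∃ v l : List A, l.Pairwise (· ≤ ·) ∧ l.toFinset = w.toFinset ∧
      (∀ y ∈ v, y ∈ l ∧ ∃ b ∈ l, b < y) ∧ plaxMk σ w = plaxMk σ (v ++ l) := by
  obtain ⟨v, l, hl, hlw, hv, hprod⟩ := (isPlaxMap_plaxMk hσ).exists_row w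
  have hmem : ∀ x, x ∈ l ↔ x ∈ w := fun x => by
    rw [← List.mem_toFinset, hlw, List.mem_toFinset]
  refine ⟨v, l, hl, hlw, by simpa only [hmem] using hv, ?_⟩
  simpa only [plaxMk_eq_prod, plaxMk_append] using hprod

/-- If `v` and `v'` agree in the stylic monoid and the rows `l`, `l'` contain all their letters,
then `v ++ l` and `v' ++ l'` agree in the σ-plactic monoid as soon as their letter counts do. -/
theorem plaxMk_append_row_eq (hσ : ∀ a, 2 ≤ σ a) {v l v' l' : List A}
    (hl : l.Pairwise (· ≤ ·)) (hl' : l'.Pairwise (· ≤ ·)) (hll : l.toFinset = l'.toFinset)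
    (hv : ∀ y ∈ v, y ∈ l) (hv' : ∀ y ∈ v', y ∈ l')
    (hvv : plaxMk (fun _ => 2) v = plaxMk (fun _ => 2) v')
    (hc : ∀ x, ExpEq (σ x) ((v ++ l).count x) ((v' ++ l').count x)) :
    plaxMk σ (v ++ l) = plaxMk σ (v' ++ l') := by
  have h := isPlaxMap_plaxMk hσ
  have hE := h.idempotents.prod_eq_of_plaxMk_eq hvv
  have key : ∀ {v l : List A}, l.Pairwise (· ≤ ·) → (∀ y ∈ v, y ∈ l) →
      plaxMk σ (v ++ l) = (v.map fun a => plaxMk σ [a] ^ (σ a - 1)).prod *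
        ((rowWord l.toFinset fun b => (v ++ l).count b).map fun a => plaxMk σ [a]).prod := by
    intro v l hl hv
    have := h.mul_row (B := l.toFinset) (m := fun b => l.count b)
      (fun b hb => by simpa [List.count_eq_zero] using hb) (v := v) (by simpa using hv)
    rw [← eq_rowWord_of_pairwise hl, plaxMk_eq_prod, plaxMk_eq_prod] at this
    rw [plaxMk_append, this]
    simp only [List.count_append]
  rw [key hl hv, key hl' hv', hE, hll]
  congr 1
  exact h.prod_rowWord_congr fun b _ => hc b

/-- The letter counts and the lengths of the longest decreasing subsequences separate the elements
of the σ-plactic monoid. -/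
theorem plaxMk_eq_of_descLength_eq {ν : A → ℕ} (hν : StrictMono ν) (hσ : ∀ a, 2 ≤ σ a)
    {w w' : List A} (hd : descLength ν w = descLength ν w')
    (hc : ∀ x, ExpEq (σ x) (w.count x) (w'.count x)) : plaxMk σ w = plaxMk σ w' := by
  induction hn : w.toFinset.card using Nat.strong_induction_on generalizing w w' σ with
  | _ n ih =>
  obtain ⟨v, l, hl, hlw, hv, hwv⟩ := exists_plaxMk_eq_append hσ w
  obtain ⟨v', l', hl', hlw', hv', hwv'⟩ := exists_plaxMk_eq_append hσ w'
  have hww : w.toFinset = w'.toFinset := by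
    ext x
    rw [List.mem_toFinset, List.mem_toFinset, mem_iff_descLength_ne_zero hν.injective, hd,
      ← mem_iff_descLength_ne_zero hν.injective]
  have hll : l.toFinset = l'.toFinset := by rw [hlw, hlw', hww]
  have hd' : descLength ν v = descLength ν v' :=
    descLength_eq_of_append_row hν hl hl' hll hv hv' <| by
      rw [← descLength_eq_of_plaxMk_eq hν hσ hwv, ← descLength_eq_of_plaxMk_eq hν hσ hwv', hd]
  rw [hwv, hwv']
  refine plaxMk_append_row_eq hσ hl hl' hll (fun y hy => (hv y hy).1) (fun y hy => (hv' y hy).1)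
    ?_ fun x => ?_
  · rcases v with _ | ⟨z, v⟩
    · rcases v' with _ | ⟨z', v'⟩
      · rfl
      · have : z' ∈ ([] : List A) := by
          rw [mem_iff_descLength_ne_zero hν.injective, hd',
            ← mem_iff_descLength_ne_zero hν.injective]
          simp
        simp at this
    · refine ih _ ?_ (fun _ => le_rfl) hd' (fun x => ⟨?_, Nat.modEq_one⟩) rfl
      · rw [← hn, ← hlw]
        refine Finset.card_lt_card (Finset.ssubset_iff_subset_ne.2 ⟨fun y hy => ?_, fun e => ?_⟩)
        · simpa using (hv y (by simpa using hy)).1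
        · have hne : l.toFinset.Nonempty := ⟨z, by simpa using (hv z (by simp)).1⟩
          have hmin := l.toFinset.min'_mem hne
          obtain ⟨-, b, hb, hlt⟩ := hv (l.toFinset.min' hne) (by
            rw [← List.mem_toFinset, e]; exact hmin)
          exact absurd (l.toFinset.min'_le b (by simpa using hb)) (not_le.2 hlt)
      · rw [List.count_eq_zero, List.count_eq_zero, mem_iff_descLength_ne_zero hν.injective, hd',
          ← mem_iff_descLength_ne_zero hν.injective]
  · exact ((expEq_count_of_plaxMk_eq hσ hwv x).symm.trans (hc x)).trans
      (expEq_count_of_plaxMk_eq hσ hwv' x)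

end Quotient

section Bell

/-- Setoids correspond under a bijection of the underlying types. -/
def Setoid.equivOfEquiv {α β : Type*} (e : α ≃ β) : Setoid α ≃ Setoid β where
  toFun r := r.comap e.symm
  invFun r := r.comap e
  left_inv r := by ext; simp [Setoid.comap_rel]
  right_inv r := by ext; simp [Setoid.comap_rel]

/-- Bundled and unbundled equivalence relations. -/
def Setoid.equivSubtype (α : Type*) : Setoid α ≃ {r : α → α → Prop // Equivalence r} where
  toFun r := ⟨r.r, r.iseqv⟩
  invFun r := ⟨r.1, r.2⟩

instance Setoid.finite (α : Type*) [Finite α] : Finite (Setoid α) :=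
  .of_equiv _ (Setoid.equivSubtype α).symm

theorem card_setoid (α : Type*) [Finite α] : Nat.card (Setoid α) = bellNumber (Nat.card α) :=
  Nat.card_congr ((Setoid.equivOfEquiv (Finite.equivFin α)).trans (Setoid.equivSubtype _))

theorem bellNumber_zero : bellNumber 0 = 1 := by
  rw [← Nat.card_fin 0, ← card_setoid, Nat.card_eq_one_iff_unique]
  exact ⟨⟨fun r s => by ext a; exact a.elim0⟩, ⟨⊥⟩⟩

/-- The setoids on `Option α` in which `S` is the set of elements not equivalent to `none`
correspond to the setoids on `S`. -/
def Setoid.optionFiberEquiv {α : Type*} (S : Set α) :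
    {r : Setoid (Option α) // {a | ¬ r (some a) none} = S} ≃ Setoid S where
  toFun r := r.1.comap fun a => some a.1
  invFun s := ⟨{
      r := fun x y => ((∀ a ∈ S, x ≠ some a) ∧ ∀ a ∈ S, y ≠ some a) ∨
        ∃ a b : S, x = some a.1 ∧ y = some b.1 ∧ s a b
      iseqv := by
        refine ⟨fun x => ?_, ?_, ?_⟩
        · by_cases h : ∀ a ∈ S, x ≠ some a
          · exact .inl ⟨h, h⟩
          · push Not at h
            obtain ⟨a, ha, rfl⟩ := h
            exact .inr ⟨⟨a, ha⟩, ⟨a, ha⟩, rfl, rfl, s.refl _⟩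
        · rintro x y (⟨h, h'⟩ | ⟨a, b, rfl, rfl, h⟩)
          · exact .inl ⟨h', h⟩
          · exact .inr ⟨b, a, rfl, rfl, s.symm h⟩
        · rintro x y z (⟨h, h'⟩ | ⟨a, b, rfl, rfl, h⟩) (⟨k, k'⟩ | ⟨c, d, hc, rfl, k⟩)
          · exact .inl ⟨h, k'⟩
          · exact absurd hc (h' c c.2)
          · exact absurd rfl (k b b.2)
          · obtain rfl : b = c := Subtype.ext (Option.some.inj hc)
            exact .inr ⟨a, d, rfl, rfl, s.trans h k⟩ }, by
      ext a
      change ¬(((∀ b ∈ S, some a ≠ some b) ∧ ∀ b ∈ S, none ≠ some b) ∨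
        ∃ b c : S, some a = some b.1 ∧ none = some c.1 ∧ s b c) ↔ a ∈ S
      simp⟩
  left_inv := by
    rintro ⟨r, rfl⟩
    refine Subtype.ext (Setoid.ext fun x y => ?_)
    have key : ∀ z : Option α, (∀ a ∈ {a | ¬ r (some a) none}, z ≠ some a) ↔ r z none := by
      rintro (_ | z)
      · simp
      · refine ⟨fun h => by_contra fun hz => h z hz rfl, fun h a ha hza => ha ?_⟩
        rwa [← hza]
    change ((∀ a ∈ _, x ≠ some a) ∧ ∀ a ∈ _, y ≠ some a) ∨ (∃ a b : {a | ¬ r (some a) none},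
      x = some a.1 ∧ y = some b.1 ∧ r (some a.1) (some b.1)) ↔ r x y
    rw [key, key]
    constructor
    · rintro (⟨h, h'⟩ | ⟨a, b, rfl, rfl, h⟩)
      · exact r.trans h (r.symm h')
      · exact h
    · intro h
      by_cases hx : r x none
      · exact .inl ⟨hx, r.trans (r.symm h) hx⟩
      · have hy : ¬ r y none := fun hy => hx (r.trans h hy)
        rcases x with _ | x
        · exact absurd (r.refl _) hx
        rcases y with _ | y
        · exact absurd (r.refl _) hy
        exact .inr ⟨⟨x, hx⟩, ⟨y, hy⟩, rfl, rfl, h⟩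
  right_inv s := by
    refine Setoid.ext fun x y => ?_
    change ((∀ a ∈ S, some x.1 ≠ some a) ∧ ∀ a ∈ S, some y.1 ≠ some a) ∨
      (∃ a b : S, some x.1 = some a.1 ∧ some y.1 = some b.1 ∧ s a b) ↔ s x y
    constructor
    · rintro (⟨h, -⟩ | ⟨a, b, ha, hb, h⟩)
      · exact absurd rfl (h x x.2)
      · obtain rfl : x = a := Subtype.ext (Option.some.inj ha)
        obtain rfl : y = b := Subtype.ext (Option.some.inj hb)
        exact h
    · exact fun h => .inr ⟨x, y, rfl, rfl, h⟩

theorem sum_powerset_bellNumber {α : Type*} (s : Finset α) :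
    ∑ S ∈ s.powerset, bellNumber S.card = bellNumber (s.card + 1) := by
  classical
  rw [Finset.sum_powerset_apply_card]
  have h := Finset.sum_powerset_apply_card (f := bellNumber) (x := (Finset.univ : Finset (Fin s.card)))
  rw [Finset.card_univ, Fintype.card_fin] at h
  rw [← h, Finset.powerset_univ]
  have e : Nat.card (Setoid (Option (Fin s.card))) = bellNumber (s.card + 1) := by
    rw [card_setoid, Nat.card_eq_fintype_card, Fintype.card_option, Fintype.card_fin]
  rw [← e, ← Nat.card_congr (Equiv.sigmaFiberEquiv fun r : Setoid (Option (Fin s.card)) =>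
    {a | ¬ r (some a) none}), Nat.card_sigma]
  refine Fintype.sum_equiv Fintype.finsetEquivSet _ _ fun S => ?_
  rw [Nat.card_congr (Setoid.optionFiberEquiv _), card_setoid]
  simp

end Bell

theorem finite_and_card_fiber {X Y : Type*} (f : X → Y) (s : Finset Y) (n : Y → ℕ)
    (h : ∀ y ∈ s, Finite {x // f x = y} ∧ Nat.card {x // f x = y} = n y) :
    Finite {x // f x ∈ s} ∧ Nat.card {x // f x ∈ s} = ∑ y ∈ s, n y := by
  have e := Equiv.sigmaSubtypeFiberEquivSubtype (p := fun x => f x ∈ s) (q := fun y => y ∈ s) f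
    fun _ => Iff.rfl
  have : ∀ y : {y // y ∈ s}, Finite {x // f x = y} := fun y => (h y.1 y.2).1
  refine ⟨.of_equiv _ e, ?_⟩
  rw [← Nat.card_congr e]
  rw [Nat.card_sigma, ← Finset.sum_coe_sort s n]
  exact Fintype.sum_congr _ _ fun y => (h y.1 y.2).2

section Count

variable {A : Type*} [LinearOrder A] {σ : A → ℕ}

/-- A word representing an element of the σ-plactic monoid. -/
noncomputable def plaxWord (q : (plaxCon σ).Quotient) : List A :=
  Function.surjInv plaxMk_surjective q

theorem plaxMk_plaxWord (q : (plaxCon σ).Quotient) : plaxMk σ (plaxWord q) = q :=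
  Function.surjInv_eq _ q

theorem plaxMk_rowWord_congr (hσ : ∀ a, 2 ≤ σ a) {B : Finset A} {m n : A → ℕ}
    (hmn : ∀ b ∈ B, ExpEq (σ b) (m b) (n b)) :
    plaxMk σ (rowWord B m) = plaxMk σ (rowWord B n) := by
  rw [← plaxMk_eq_prod, ← plaxMk_eq_prod]
  exact (isPlaxMap_plaxMk hσ).prod_rowWord_congr hmn

theorem plaxMk_two_eq_of_plaxMk_eq (hσ : ∀ a, 2 ≤ σ a) {u v : List A}
    (h : plaxMk σ u = plaxMk σ v) : plaxMk (fun _ => 2) u = plaxMk (fun _ => 2) v := by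
  have h₂ := isPlaxMap_plaxMk (A := A) (σ := fun _ => 2) fun _ => le_rfl
  have : IsPlaxMap σ fun a : A => plaxMk (fun _ => 2) [a] :=
    { two_le := hσ
      knuth_left := h₂.knuth_left
      knuth_right := h₂.knuth_right
      pow_eq := fun a => by
        have := h₂.pow_eq_pow (a := a) (m := σ a) (n := 1)
          ⟨by have := hσ a; omega, Nat.modEq_one⟩
        simpa using this }
  simpa only [plaxMk_eq_prod] using this.prod_eq_of_plaxMk_eq h

theorem plaxMk_two_eq_of_descLength_eq {ν : A → ℕ} (hν : StrictMono ν) {u v : List A}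
    (h : descLength ν u = descLength ν v) :
    plaxMk (fun _ => 2) u = plaxMk (fun _ => 2) v := by
  refine plaxMk_eq_of_descLength_eq hν (fun _ => le_rfl) h fun x => ⟨?_, Nat.modEq_one⟩
  rw [List.count_eq_zero, List.count_eq_zero, mem_iff_descLength_ne_zero hν.injective, h,
    ← mem_iff_descLength_ne_zero hν.injective]

theorem toFinset_plaxWord (hσ : ∀ a, 2 ≤ σ a) (w : List A) :
    (plaxWord (plaxMk σ w)).toFinset = w.toFinset :=
  toFinset_eq_of_plaxMk_eq hσ (plaxMk_plaxWord _)

/-- The number of elements of the stylic monoid with a given set of letters is a Bell number. -/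
theorem card_stylic_fiber {ν : A → ℕ} (hν : StrictMono ν) (B : Finset A) :
    Finite {q : (plaxCon fun _ : A => 2).Quotient // (plaxWord q).toFinset = B} ∧
      Nat.card {q : (plaxCon fun _ : A => 2).Quotient // (plaxWord q).toFinset = B} =
        bellNumber B.card := by
  have h₂ : ∀ a : A, 2 ≤ (fun _ => 2) a := fun _ => le_rfl
  induction hn : B.card using Nat.strong_induction_on generalizing B with
  | _ n ih =>
  rcases B.eq_empty_or_nonempty with rfl | hB
  · have : Unique {q : (plaxCon fun _ : A => 2).Quotient // (plaxWord q).toFinset = ∅} :=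
      { default := ⟨plaxMk _ [], by rw [toFinset_plaxWord h₂]; rfl⟩
        uniq := by
          rintro ⟨q, hq⟩
          refine Subtype.ext ?_
          rw [List.toFinset_eq_empty_iff] at hq
          change q = plaxMk _ []
          rw [← plaxMk_plaxWord q, hq] }
    refine ⟨inferInstance, ?_⟩
    rw [Nat.card_unique, ← hn, Finset.card_empty, bellNumber_zero]
  · set C := B.erase (B.min' hB) with hC
    have hCB : C.card + 1 = B.card := Finset.card_erase_add_one (B.min'_mem hB)
    have hmemC : ∀ y, y ∈ C ↔ y ∈ B ∧ ∃ b ∈ B, b < y := fun y => by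
      rw [hC, Finset.mem_erase]
      constructor
      · rintro ⟨hy, hyB⟩
        exact ⟨hyB, _, B.min'_mem hB, lt_of_le_of_ne (B.min'_le y hyB) (Ne.symm hy)⟩
      · rintro ⟨hyB, b, hb, hby⟩
        exact ⟨((B.min'_le b hb).trans_lt hby).ne', hyB⟩
    obtain ⟨hf, hcard⟩ := finite_and_card_fiber
      (fun q : (plaxCon fun _ : A => 2).Quotient => (plaxWord q).toFinset) C.powerset
      (fun S => bellNumber S.card) fun S hS =>
        ih S.card (by have := Finset.card_le_card (Finset.mem_powerset.1 hS); omega) S rfl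
    set l := rowWord B fun _ => 1 with hl_def
    have hl : l.Pairwise (· ≤ ·) := pairwise_rowWord _ _
    have hlB : l.toFinset = B := toFinset_rowWord (by simp)
    have hml : ∀ y, y ∈ l ↔ y ∈ B := fun y => by rw [← List.mem_toFinset, hlB]
    have hmem : ∀ v : List A, v.toFinset ∈ C.powerset ↔ ∀ y ∈ v, y ∈ l ∧ ∃ b ∈ l, b < y := by
      intro v
      rw [Finset.mem_powerset]
      simp only [hml, ← hmemC, Finset.subset_iff, List.mem_toFinset]
    let φ : {q : (plaxCon fun _ : A => 2).Quotient // (plaxWord q).toFinset ∈ C.powerset} →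
        {q : (plaxCon fun _ : A => 2).Quotient // (plaxWord q).toFinset = B} := fun q =>
      ⟨plaxMk _ (plaxWord q.1 ++ l), by
        rw [toFinset_plaxWord h₂, List.toFinset_append, hlB, Finset.union_eq_right]
        exact (Finset.mem_powerset.1 q.2).trans (Finset.erase_subset _ _)⟩
    have hφ : Function.Bijective φ := by
      constructor
      · rintro ⟨q, hq⟩ ⟨q', hq'⟩ h
        have h' := descLength_eq_of_plaxMk_eq hν h₂ (congrArg Subtype.val h)
        refine Subtype.ext ?_
        change q = q'
        rw [← plaxMk_plaxWord q, ← plaxMk_plaxWord q']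
        exact plaxMk_two_eq_of_descLength_eq hν
          (descLength_eq_of_append_row hν hl hl rfl ((hmem _).1 hq) ((hmem _).1 hq') h')
      · rintro ⟨q, hq⟩
        obtain ⟨v, l', hl', hlq, hv, hqv⟩ := exists_plaxMk_eq_append h₂ (plaxWord q)
        have hll : plaxMk (fun _ : A => 2) l' = plaxMk _ l := by
          rw [eq_rowWord_of_pairwise hl', hlq, hq]
          refine plaxMk_rowWord_congr h₂ fun b hb => ⟨?_, Nat.modEq_one⟩
          have : b ∈ l' := by rwa [← List.mem_toFinset, hlq, hq]
          simpa [List.count_eq_zero] using this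
        have hmem' : ∀ x, x ∈ l' ↔ x ∈ l := fun x => by
          rw [← List.mem_toFinset, hlq, hq, hml]
        refine ⟨⟨plaxMk _ v, ?_⟩, Subtype.ext ?_⟩
        · rw [toFinset_plaxWord h₂, hmem]
          simpa only [hmem'] using hv
        · change plaxMk _ (plaxWord (plaxMk _ v) ++ l) = q
          rw [plaxMk_append, plaxMk_plaxWord, ← hll, ← plaxMk_append, ← hqv, plaxMk_plaxWord]
    refine ⟨.of_equiv _ (Equiv.ofBijective φ hφ), ?_⟩
    rw [← Nat.card_congr (Equiv.ofBijective φ hφ), hcard, sum_powerset_bellNumber, hCB, hn]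

/-- The number of elements of the σ-plactic monoid with a given set of letters. -/
theorem card_plax_fiber {ν : A → ℕ} (hν : StrictMono ν) (hσ : ∀ a, 2 ≤ σ a) (B : Finset A) :
    Finite {q : (plaxCon σ).Quotient // (plaxWord q).toFinset = B} ∧
      Nat.card {q : (plaxCon σ).Quotient // (plaxWord q).toFinset = B} =
        bellNumber B.card * ∏ b ∈ B, (σ b - 1) := by
  have h₂ : ∀ a : A, 2 ≤ (fun _ => 2) a := fun _ => le_rfl
  have : ∀ b : B, NeZero (σ b - 1) := fun b => ⟨by have := hσ b; omega⟩
  obtain ⟨hf, hcard⟩ := card_stylic_fiber hν B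
  let φ : {q : (plaxCon σ).Quotient // (plaxWord q).toFinset = B} →
      {q : (plaxCon fun _ : A => 2).Quotient // (plaxWord q).toFinset = B} ×
        (∀ b : B, ZMod (σ b - 1)) := fun q =>
    (⟨plaxMk _ (plaxWord q.1), by rw [toFinset_plaxWord h₂, q.2]⟩,
      fun b => ((plaxWord q.1).count b.1 : ZMod (σ b - 1)))
  have hφ : Function.Bijective φ := by
    constructor
    · rintro ⟨q, hq⟩ ⟨q', hq'⟩ h
      have h₁ : plaxMk (fun _ => 2) (plaxWord q) = plaxMk (fun _ => 2) (plaxWord q') :=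
        congrArg (fun z => z.1.1) h
      have h₃ := congrArg Prod.snd h
      refine Subtype.ext ?_
      change q = q'
      rw [← plaxMk_plaxWord q, ← plaxMk_plaxWord q']
      refine plaxMk_eq_of_descLength_eq hν hσ (descLength_eq_of_plaxMk_eq hν h₂ h₁) fun x => ?_
      have hx : ∀ p : (plaxCon σ).Quotient, (plaxWord p).toFinset = B →
          ((plaxWord p).count x = 0 ↔ x ∉ B) := fun p hp => by
        rw [List.count_eq_zero, ← hp, List.mem_toFinset]
      refine ⟨(hx q hq).trans (hx q' hq').symm, ?_⟩
      by_cases hxB : x ∈ B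
      · exact (ZMod.natCast_eq_natCast_iff _ _ _).1 (congrFun h₃ ⟨x, hxB⟩)
      · rw [(hx q hq).2 hxB, (hx q' hq').2 hxB]
    · rintro ⟨⟨p, hp⟩, k⟩
      obtain ⟨v, l, hl, hlp, hv, hpv⟩ := exists_plaxMk_eq_append h₂ (plaxWord p)
      rw [hp] at hlp
      have hml : ∀ y, y ∈ l ↔ y ∈ B := fun y => by rw [← List.mem_toFinset, hlp]
      let m : A → ℕ := fun b =>
        if h : b ∈ B then (k ⟨b, h⟩ - (v.count b : ZMod (σ b - 1))).val + (σ b - 1) else 0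
      have hm : ∀ b ∈ B, m b ≠ 0 := fun b hb => by
        have := hσ b
        simp only [m, dif_pos hb]
        omega
      have hw : plaxMk (fun _ => 2) (v ++ rowWord B m) = p := by
        rw [← plaxMk_plaxWord p, hpv, plaxMk_append, plaxMk_append]
        congr 1
        rw [eq_rowWord_of_pairwise hl, hlp]
        refine plaxMk_rowWord_congr h₂ fun b hb => ⟨?_, Nat.modEq_one⟩
        simpa [hm b hb, List.count_eq_zero] using (hml b).2 hb
      have hq := plaxMk_plaxWord (plaxMk σ (v ++ rowWord B m))
      refine ⟨⟨plaxMk σ (v ++ rowWord B m), ?_⟩, ?_⟩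
      · rw [toFinset_plaxWord hσ, List.toFinset_append, toFinset_rowWord hm, Finset.union_eq_right]
        intro y hy
        exact (hml y).1 (hv y (List.mem_toFinset.1 hy)).1
      · refine Prod.ext (Subtype.ext ?_) (funext fun b => ?_)
        · exact (plaxMk_two_eq_of_plaxMk_eq hσ hq).trans hw
        · have hb := (ZMod.natCast_eq_natCast_iff _ _ _).2 (expEq_count_of_plaxMk_eq hσ hq b.1).2
          refine hb.trans ?_
          rw [List.count_append, count_rowWord b.2]
          simp only [m, dif_pos b.2]
          push_cast
          simp
  refine ⟨.of_equiv _ (Equiv.ofBijective φ hφ).symm, ?_⟩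
  rw [Nat.card_congr (Equiv.ofBijective φ hφ), Nat.card_prod, hcard, Nat.card_pi]
  simp only [Nat.card_zmod]
  rw [Finset.prod_coe_sort B fun b => σ b - 1]

end Count

/-- The σ-plactic monoid `Plax(A, σ)` is finite, of cardinality
`Σ_{B ⊆ A} Bell(|B|) · Π_{b ∈ B} (σ(b) - 1)`. -/
theorem card_plax {A : Type*} [LinearOrder A] [Fintype A]
    (σ : A → ℕ) (hσ : ∀ a : A, 2 ≤ σ a) :
    Finite (plaxCon σ).Quotient ∧
      Nat.card (plaxCon σ).Quotient =
        ∑ B : Finset A, bellNumber B.card * ∏ b ∈ B, (σ b - 1) := by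
  let ν : A → ℕ := fun a => (Fintype.orderIsoFinOfCardEq A rfl).symm a
  have hν : StrictMono ν := fun a b h => (Fintype.orderIsoFinOfCardEq A rfl).symm.strictMono h
  obtain ⟨hf, hcard⟩ := finite_and_card_fiber
    (fun q : (plaxCon σ).Quotient => (plaxWord q).toFinset) Finset.univ
    (fun B => bellNumber B.card * ∏ b ∈ B, (σ b - 1)) fun B _ => card_plax_fiber hν hσ B
  have e := Equiv.subtypeUnivEquiv fun q : (plaxCon σ).Quotient =>
    Finset.mem_univ (plaxWord q).toFinset
  exact ⟨.of_equiv _ e, (Nat.card_congr e).symm.trans hcard⟩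
end
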